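/- Let F/K be a finite Galois extension of number fields with Galois group G, let d be the degree of K over ℚ, let S∞ be the set of archimedean places of F, and let μ_F be the group of roots of unity of F. Then the equality [Ãr_F] = d·[ℤ[G]] − [ℤ] holds in G₀(ℤ[G]) if and only if the equality [Ar_F] = [ℤ[S∞]] − [ℤ] − σ[μ_F] holds in G₀(ℤ[G]). -/

import Mathlib

/-- A bundled finitely generated module over a ring `R`. -/
structure FGMod (R : Type) [Ring R] : Type 1 where
  carrier : Type
  [isAddCommGroup : AddCommGroup carrier]
  [isModule : Module R carrier]
  [isFinite : Module.Finite R carrier]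

attribute [instance] FGMod.isAddCommGroup FGMod.isModule FGMod.isFinite

/-- The subgroup of relations defining the Grothendieck group `G₀(R)`:
one relation `[M] = [L] + [N]` for each short exact sequence `0 → L → M → N → 0`
of finitely generated `R`-modules. -/
def G0Rel (R : Type) [Ring R] : AddSubgroup (FreeAbelianGroup (FGMod R)) :=
  AddSubgroup.closure
    { x | ∃ (L M N : FGMod R) (f : L.carrier →ₗ[R] M.carrier)
            (g : M.carrier →ₗ[R] N.carrier),
        Function.Injective f ∧ Function.Surjective g ∧ Function.Exact f g ∧
        x = FreeAbelianGroup.of M - FreeAbelianGroup.of L - FreeAbelianGroup.of N }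

/-- The Grothendieck group `G₀(R)` of the category of finitely generated `R`-modules. -/
def G0 (R : Type) [Ring R] : Type 1 :=
  FreeAbelianGroup (FGMod R) ⧸ G0Rel R

instance (R : Type) [Ring R] : AddCommGroup (G0 R) :=
  QuotientAddGroup.Quotient.addCommGroup _

/-- The class `[M] ∈ G₀(R)` of a finitely generated `R`-module `M` (junk value `0` if `M` is
not finitely generated). -/
noncomputable def G0.cls (R : Type) [Ring R] (M : Type) [AddCommGroup M] [Module R M] :
    G0 R := by
  classical
  exact
    if h : Module.Finite R M then
      QuotientAddGroup.mk (FreeAbelianGroup.of (@FGMod.mk R _ M _ _ h))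
    else 0

open NumberField
open scoped nonZeroDivisors TensorProduct

noncomputable section

variable (F : Type) [Field F] [NumberField F]

/-- The étale ℝ-algebra F_ℝ = F ⊗_ℚ ℝ. -/
abbrev FReal := ℝ ⊗[ℚ] F

/-- The canonical (finite-dimensional real vector space) topology on F_ℝ. -/
instance : TopologicalSpace (FReal F) :=
  TopologicalSpace.induced (Module.finBasis ℝ (FReal F)).equivFun inferInstance

/-- The group of fractional ideals of F. -/
abbrev IdealGroup := (FractionalIdeal (𝓞 F)⁰ F)ˣ

/-- The group of fractional ideals carries the discrete topology. -/
instance : TopologicalSpace (IdealGroup F) := ⊥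

/-- The ideal norm, as a group homomorphism to ℝˣ. -/
def idealNormHom : IdealGroup F →* ℝˣ :=
  (Units.map (Rat.castHom ℝ).toMonoidHom).comp
    (Units.map (FractionalIdeal.absNorm (R := 𝓞 F) (K := F)).toMonoidHom)

/-- The absolute value of the algebra norm on F_ℝˣ, as a group homomorphism to ℝˣ. -/
def absNormFR : (FReal F)ˣ →* ℝˣ :=
  (Units.map (absHom (α := ℝ)).toMonoidHom).comp (Units.map (Algebra.norm ℝ (S := FReal F)))

/-- The fibre product Id_F ×_{ℝ>0} F_ℝˣ, i.e. the subgroup of pairs (I, b) with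
N(I) = |Nm(b)|, formalized as the kernel of the quotient of the two norm maps. -/
def picDom : Subgroup (IdealGroup F × (FReal F)ˣ) :=
  MonoidHom.ker (((idealNormHom F).comp (MonoidHom.fst _ _)) /
    ((absNormFR F).comp (MonoidHom.snd _ _)))

/-- The map F^× → Id_F ×_{ℝ>0} F_ℝˣ, α ↦ (αO_F, α ⊗ 1). -/
def principalHom : Fˣ →* IdealGroup F × (FReal F)ˣ :=
  (toPrincipalIdeal (𝓞 F) F).prod
    (Units.map (Algebra.TensorProduct.includeRight : F →ₐ[ℚ] FReal F).toMonoidHom)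

/-- The subgroup of the fibre product coming from principal oriented Arakelov divisors. -/
def principalSub : Subgroup (picDom F) :=
  Subgroup.comap (picDom F).subtype (MonoidHom.range (principalHom F))

/-- The oriented Arakelov class group of F: the cokernel of F^× → Id_F ×_{ℝ>0} F_ℝˣ. -/
def PicTilde := picDom F ⧸ principalSub F

instance : CommGroup (PicTilde F) := QuotientGroup.Quotient.commGroup _
instance : TopologicalSpace (PicTilde F) := instTopologicalSpaceQuotient

/-- The class of an oriented Arakelov divisor in the oriented Arakelov class group. -/
def PicTilde.mk : picDom F → PicTilde F := QuotientGroup.mk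

/-- The maximal compact subgroup comp(F_ℝˣ) of F_ℝˣ: the subgroup generated by all
compact subgroups. -/
def maxCompact : Subgroup (FReal F)ˣ :=
  sSup { H : Subgroup (FReal F)ˣ | IsCompact (H : Set (FReal F)ˣ) }

/-- The image of {1} × comp(F_ℝˣ) in the oriented Arakelov class group. -/
def compImage : Subgroup (PicTilde F) :=
  Subgroup.map (QuotientGroup.mk' (principalSub F))
    (Subgroup.comap (picDom F).subtype ((⊥ : Subgroup (IdealGroup F)).prod (maxCompact F)))

/-- The Arakelov class group of F: the quotient of the oriented Arakelov class group by
the image of {1} × comp(F_ℝˣ). -/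
def PicZero := PicTilde F ⧸ compImage F

instance : CommGroup (PicZero F) := QuotientGroup.Quotient.commGroup _
instance : TopologicalSpace (PicZero F) := instTopologicalSpaceQuotient

/-- The class of an oriented Arakelov divisor in the Arakelov class group. -/
def PicZero.mk : picDom F → PicZero F := fun x => QuotientGroup.mk (PicTilde.mk F x)

/-- ℝ/ℤ. -/
abbrev RmodZ := AddCircle (1 : ℝ)

/-- The Pontryagin dual Ãr_F of the oriented Arakelov class group: the group of
continuous homomorphisms to ℝ/ℤ. -/
def ArTilde := ContinuousAddMonoidHom (Additive (PicTilde F)) RmodZ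

instance : AddCommGroup (ArTilde F) := by unfold ArTilde; infer_instance
instance : FunLike (ArTilde F) (Additive (PicTilde F)) RmodZ := by unfold ArTilde; infer_instance

/-- The Pontryagin dual Ar_F of the Arakelov class group. -/
def ArF := ContinuousAddMonoidHom (Additive (PicZero F)) RmodZ

instance : AddCommGroup (ArF F) := by unfold ArF; infer_instance
instance : FunLike (ArF F) (Additive (PicZero F)) RmodZ := by unfold ArF; infer_instance

/-- ℚ/ℤ as a ℤ-module. -/
abbrev QmodZ := ℚ ⧸ (Submodule.span ℤ {(1 : ℚ)})

variable {F} in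
/-- The automorphism of F_ℝ = ℝ ⊗_ℚ F induced by an automorphism of F over a subfield K. -/
def galFReal (K : Type) [Field K] [CharZero K] [Algebra K F] (g : F ≃ₐ[K] F) : FReal F ≃ₐ[ℚ] FReal F :=
  Algebra.TensorProduct.congr AlgEquiv.refl (g.restrictScalars ℚ)

end

section GrothendieckGroup

theorem G0.cls_eq_mk {R : Type} [Ring R] {M : Type} [AddCommGroup M] [Module R M]
    [h : Module.Finite R M] : G0.cls R M =
      (QuotientAddGroup.mk (FreeAbelianGroup.of (FGMod.mk (R := R) M)) :
        FreeAbelianGroup (FGMod R) ⧸ G0Rel R) :=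
  dif_pos h

theorem G0.cls_of_exact {R : Type} [Ring R] {L M N : Type} [AddCommGroup L] [Module R L]
    [AddCommGroup M] [Module R M] [AddCommGroup N] [Module R N] [hL : Module.Finite R L]
    [hM : Module.Finite R M] [hN : Module.Finite R N] (f : L →ₗ[R] M) (g : M →ₗ[R] N)
    (hf : Function.Injective f) (hg : Function.Surjective g) (h : Function.Exact f g) :
    G0.cls R M = G0.cls R L + G0.cls R N := by
  have key : (QuotientAddGroup.mk (FreeAbelianGroup.of (FGMod.mk (R := R) M) -
      FreeAbelianGroup.of (FGMod.mk (R := R) L) - FreeAbelianGroup.of (FGMod.mk (R := R) N)) :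
      FreeAbelianGroup (FGMod R) ⧸ G0Rel R) = 0 :=
    (QuotientAddGroup.eq_zero_iff _).2
      (AddSubgroup.subset_closure ⟨⟨L⟩, ⟨M⟩, ⟨N⟩, f, g, hf, hg, h, rfl⟩)
  rw [G0.cls_eq_mk, G0.cls_eq_mk, G0.cls_eq_mk]
  rw [QuotientAddGroup.mk_sub, QuotientAddGroup.mk_sub, sub_sub, sub_eq_zero] at key
  exact key

theorem G0.cls_eq_zero_of_subsingleton {R : Type} [Ring R] (M : Type) [AddCommGroup M]
    [Module R M] [Subsingleton M] : G0.cls R M = 0 := by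
  have := G0.cls_of_exact (R := R) (L := M) (M := M) (N := M) LinearMap.id LinearMap.id
    Function.injective_id Function.surjective_id
    (fun x => ⟨fun _ => ⟨x, rfl⟩, fun _ => Subsingleton.elim _ _⟩)
  simpa using this

theorem G0.cls_congr {R : Type} [Ring R] {M N : Type} [AddCommGroup M]
    [Module R M] [AddCommGroup N] [Module R N] [Module.Finite R M] (e : M ≃ₗ[R] N) :
    G0.cls R M = G0.cls R N := by
  have : Module.Finite R N := Module.Finite.equiv e
  have := G0.cls_of_exact (R := R) (L := M) (M := N) (N := PUnit) e.toLinearMap 0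
    e.injective (fun x => ⟨0, Subsingleton.elim _ _⟩)
    (fun x => ⟨fun _ => ⟨e.symm x, by simp⟩, fun _ => rfl⟩)
  rw [this, G0.cls_eq_zero_of_subsingleton PUnit, add_zero]

theorem G0.cls_eq_ker_add {R : Type} [Ring R] [IsNoetherianRing R] {M N : Type} [AddCommGroup M]
    [Module R M] [AddCommGroup N] [Module R N] [Module.Finite R M] (f : M →ₗ[R] N)
    (hf : Function.Surjective f) :
    G0.cls R M = G0.cls R (LinearMap.ker f) + G0.cls R N := by
  have : Module.Finite R N := Module.Finite.of_surjective f hf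
  exact G0.cls_of_exact (LinearMap.ker f).subtype f (Submodule.subtype_injective _) hf
    (LinearMap.exact_subtype_ker_map f)

theorem G0.cls_finFun (R : Type) [Ring R] (n : ℕ) : G0.cls R (Fin n → R) = n • G0.cls R R := by
  induction n with
  | zero => rw [zero_smul]; exact G0.cls_eq_zero_of_subsingleton _
  | succ n ih =>
    rw [G0.cls_congr (Fin.consLinearEquiv R (fun _ : Fin (n + 1) => R)).symm,
      G0.cls_of_exact (LinearMap.inl R R (Fin n → R)) (LinearMap.snd R R (Fin n → R))
      LinearMap.inl_injective LinearMap.snd_surjective Function.Exact.inl_snd, ih, succ_nsmul,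
      add_comm]

theorem G0.cls_pi (R : Type) [Ring R] (ι : Type) [Finite ι] :
    G0.cls R (ι → R) = Nat.card ι • G0.cls R R := by
  rw [G0.cls_congr (LinearEquiv.funCongrLeft R R (Finite.equivFin ι).symm), G0.cls_finFun]

end GrothendieckGroup

section GroupRing

variable {G : Type} [Group G]

theorem MonoidAlgebra.smul_mem_of_single_smul_mem {M : Type} [AddCommGroup M]
    [Module (MonoidAlgebra ℤ G) M] (S : AddSubgroup M)
    (h : ∀ (g : G) (m : M), m ∈ S → (MonoidAlgebra.single g (1 : ℤ) : MonoidAlgebra ℤ G) • m ∈ S)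
    (a : MonoidAlgebra ℤ G) (m : M) (hm : m ∈ S) : a • m ∈ S := by
  induction a using MonoidAlgebra.induction_on with
  | of g => exact h g m hm
  | add a b ha hb => rw [add_smul]; exact S.add_mem ha hb
  | smul r a ha => rw [smul_assoc]; exact S.zsmul_mem ha r

/-- An additive subgroup stable under the group elements, as a submodule over the group ring. -/
def AddSubgroup.toGroupRingSubmodule {M : Type} [AddCommGroup M] [Module (MonoidAlgebra ℤ G) M]
    (S : AddSubgroup M)
    (h : ∀ (g : G) (m : M), m ∈ S → (MonoidAlgebra.single g (1 : ℤ) : MonoidAlgebra ℤ G) • m ∈ S) :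
    Submodule (MonoidAlgebra ℤ G) M where
  __ := S
  smul_mem' a m hm := MonoidAlgebra.smul_mem_of_single_smul_mem S h a m hm

/-- An additive map commuting with the group elements, as a linear map over the group ring. -/
def AddMonoidHom.toGroupRingLinearMap {M N : Type} [AddCommGroup M] [Module (MonoidAlgebra ℤ G) M]
    [AddCommGroup N] [Module (MonoidAlgebra ℤ G) N] (f : M →+ N)
    (h : ∀ (g : G) (m : M), f ((MonoidAlgebra.single g (1 : ℤ) : MonoidAlgebra ℤ G) • m) =
      (MonoidAlgebra.single g (1 : ℤ) : MonoidAlgebra ℤ G) • f m) :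
    M →ₗ[MonoidAlgebra ℤ G] N where
  __ := f
  map_smul' a m := by
    change f (a • m) = a • f m
    induction a using MonoidAlgebra.induction_on with
    | of g => exact h g m
    | add a b ha hb => rw [add_smul, map_add, ha, hb, add_smul]
    | smul r a ha => rw [smul_assoc, map_zsmul, ha, smul_assoc]

/-- The group ring module structure attached to a representation on an abelian group. -/
noncomputable abbrev groupRingModule {M : Type} [AddCommGroup M] (ρ : G →* Module.End ℤ M) :
    Module (MonoidAlgebra ℤ G) M :=
  Module.compHom M (MonoidAlgebra.lift ℤ (Module.End ℤ M) G ρ).toRingHom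

theorem groupRingModule_single_smul {M : Type} [AddCommGroup M] (ρ : G →* Module.End ℤ M) (g : G)
    (m : M) : letI := groupRingModule ρ
    (MonoidAlgebra.single g (1 : ℤ) : MonoidAlgebra ℤ G) • m = ρ g m := by
  change (MonoidAlgebra.lift ℤ (Module.End ℤ M) G ρ) (MonoidAlgebra.single g 1) m = _
  simp

theorem finite_groupRing {M : Type} [AddCommGroup M] [Module (MonoidAlgebra ℤ G) M]
    [Module.Finite ℤ M] : Module.Finite (MonoidAlgebra ℤ G) M :=
  Module.Finite.of_restrictScalars_finite ℤ _ M

instance isNoetherianRing_groupRing [Finite G] : IsNoetherianRing (MonoidAlgebra ℤ G) := by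
  have : Module.Finite ℤ (MonoidAlgebra ℤ G) := inferInstance
  exact IsNoetherianRing.of_finite ℤ _

end GroupRing

section RealAlgebra

variable (F : Type) [Field F] [NumberField F]

/-- The canonical algebra map from `F_ℝ` to the mixed space. -/
noncomputable def FReal.toMixedHom : FReal F →ₐ[ℝ] mixedEmbedding.mixedSpace F :=
  Algebra.TensorProduct.lift (Algebra.ofId ℝ _) (mixedEmbedding F).toRatAlgHom
    (fun _ _ => Commute.all _ _)

theorem FReal.toMixedHom_tmul (r : ℝ) (a : F) :
    FReal.toMixedHom F (r ⊗ₜ a) = r • mixedEmbedding F a := by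
  simp [FReal.toMixedHom, Algebra.smul_def, Algebra.ofId_apply]

theorem FReal.toMixedHom_bijective : Function.Bijective (FReal.toMixedHom F) := by
  have hs : Function.Surjective (FReal.toMixedHom F).toLinearMap := by
    rw [← LinearMap.range_eq_top, ← (mixedEmbedding.latticeBasis F).span_eq, eq_comm]
    refine le_antisymm (Submodule.span_le.2 ?_) (by
      rw [(mixedEmbedding.latticeBasis F).span_eq]; exact le_top)
    rintro _ ⟨i, rfl⟩
    refine ⟨1 ⊗ₜ (integralBasis F i), ?_⟩
    rw [mixedEmbedding.latticeBasis_apply]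
    exact (FReal.toMixedHom_tmul F 1 _).trans (one_smul _ _)
  have hd : Module.finrank ℝ (FReal F) = Module.finrank ℝ (mixedEmbedding.mixedSpace F) := by
    rw [mixedEmbedding.finrank, Module.finrank_baseChange]
  exact ⟨(LinearMap.injective_iff_surjective_of_finrank_eq_finrank hd).2 hs, hs⟩

/-- The identification of `F_ℝ` with the mixed space. -/
noncomputable def FReal.toMixed : FReal F ≃ₐ[ℝ] mixedEmbedding.mixedSpace F :=
  AlgEquiv.ofBijective (FReal.toMixedHom F) (FReal.toMixedHom_bijective F)

variable {F}

theorem FReal.toMixed_tmul (r : ℝ) (a : F) :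
    FReal.toMixed F (r ⊗ₜ a) = r • mixedEmbedding F a :=
  FReal.toMixedHom_tmul F r a

theorem FReal.continuous_toMixed : Continuous (FReal.toMixed F) := by
  have h : Continuous (Module.finBasis ℝ (FReal F)).equivFun := continuous_induced_dom
  have h2 : Continuous ((FReal.toMixed F).toLinearMap ∘ₗ
    (Module.finBasis ℝ (FReal F)).equivFun.symm.toLinearMap) :=
    LinearMap.continuous_of_finiteDimensional _
  convert! h2.comp h using 1
  ext1 x
  simp

theorem FReal.continuous_toMixed_symm : Continuous (FReal.toMixed F).symm := by
  rw [continuous_induced_rng]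
  exact LinearMap.continuous_of_finiteDimensional ((Module.finBasis ℝ (FReal F)).equivFun.toLinearMap ∘ₗ
    (FReal.toMixed F).symm.toLinearMap)

theorem FReal.abs_norm_eq (b : FReal F) :
    |Algebra.norm ℝ b| = mixedEmbedding.norm (FReal.toMixed F b) := by
  have h1 : Algebra.norm ℝ b = Algebra.norm ℝ (FReal.toMixed F b) := by
    rw [Algebra.norm_eq_of_algEquiv]
  rw [h1]
  generalize FReal.toMixed F b = x
  obtain ⟨y, z⟩ := x
  have h2 : Algebra.lmul ℝ (mixedEmbedding.mixedSpace F) (y, z) =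
    LinearMap.prodMap
      (LinearMap.pi fun w => (Algebra.lmul ℝ ℝ (y w)) ∘ₗ LinearMap.proj w)
      (LinearMap.pi fun w => (Algebra.lmul ℝ ℂ (z w)) ∘ₗ LinearMap.proj w) := by
    ext1 <;> rfl
  classical
  rw [Algebra.norm_apply, h2, LinearMap.det_prodMap, LinearMap.det_pi, LinearMap.det_pi, abs_mul,
    Finset.abs_prod, Finset.abs_prod, mixedEmbedding.norm_apply,
    InfinitePlace.prod_eq_prod_mul_prod]
  congr 1 <;> refine Finset.prod_congr (by congr!) fun w _ => ?_
  · rw [← Algebra.norm_apply, mixedEmbedding.normAtPlace_apply_of_isReal w.2,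
      InfinitePlace.mult_isReal, pow_one]
    simp
  · rw [← Algebra.norm_apply, mixedEmbedding.normAtPlace_apply_of_isComplex w.2,
      InfinitePlace.mult_isComplex, Algebra.norm_complex_apply, Complex.normSq_eq_norm_sq]
    simp

/-- The algebra map from `F_ℝ` to `ℂ` attached to an embedding of `F`. -/
noncomputable def FReal.ev (τ : F →+* ℂ) : FReal F →ₐ[ℝ] ℂ :=
  Algebra.TensorProduct.lift (Algebra.ofId ℝ _) τ.toRatAlgHom (fun _ _ => Commute.all _ _)

theorem FReal.ev_tmul (τ : F →+* ℂ) (r : ℝ) (a : F) : FReal.ev τ (r ⊗ₜ a) = r * τ a := by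
  simp [FReal.ev, Algebra.ofId_apply]

theorem FReal.ev_conjugate (τ : F →+* ℂ) (b : FReal F) :
    FReal.ev (ComplexEmbedding.conjugate τ) b = (starRingEnd ℂ) (FReal.ev τ b) := by
  induction b using TensorProduct.induction_on with
  | zero => simp
  | tmul r a => simp [FReal.ev_tmul]
  | add x y hx hy => simp [hx, hy]

theorem FReal.ev_galFReal {K : Type} [Field K] [CharZero K] [Algebra K F] (g : F ≃ₐ[K] F)
    (τ : F →+* ℂ) (b : FReal F) :
    FReal.ev τ (galFReal K g b) = FReal.ev (τ.comp (g : F →+* F)) b := by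
  induction b using TensorProduct.induction_on with
  | zero => simp
  | tmul r a => simp [FReal.ev_tmul, galFReal]
  | add x y hx hy => simp [hx, hy]

theorem FReal.ev_embedding_of_isReal (w : {w : InfinitePlace F // w.IsReal}) (b : FReal F) :
    FReal.ev w.1.embedding b = ((FReal.toMixed F b).1 w : ℂ) := by
  induction b using TensorProduct.induction_on with
  | zero => simp
  | tmul r a => simp [FReal.ev_tmul, FReal.toMixed_tmul]
  | add x y hx hy => simp [hx, hy]

theorem FReal.ev_embedding_of_isComplex (w : {w : InfinitePlace F // w.IsComplex}) (b : FReal F) :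
    FReal.ev w.1.embedding b = (FReal.toMixed F b).2 w := by
  induction b using TensorProduct.induction_on with
  | zero => simp
  | tmul r a => simp [FReal.ev_tmul, FReal.toMixed_tmul]
  | add x y hx hy => simp [hx, hy]

theorem FReal.norm_ev_embedding (w : InfinitePlace F) (b : FReal F) :
    ‖FReal.ev w.embedding b‖ = mixedEmbedding.normAtPlace w (FReal.toMixed F b) := by
  by_cases h : w.IsReal
  · rw [mixedEmbedding.normAtPlace_apply_of_isReal h, FReal.ev_embedding_of_isReal ⟨w, h⟩]
    simp
  · rw [InfinitePlace.not_isReal_iff_isComplex] at h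
    rw [mixedEmbedding.normAtPlace_apply_of_isComplex h, FReal.ev_embedding_of_isComplex ⟨w, h⟩]

theorem FReal.norm_ev (τ : F →+* ℂ) (b : FReal F) :
    ‖FReal.ev τ b‖ = mixedEmbedding.normAtPlace (InfinitePlace.mk τ) (FReal.toMixed F b) := by
  rw [← FReal.norm_ev_embedding]
  rcases InfinitePlace.embedding_mk_eq τ with h | h <;> rw [h]
  rw [FReal.ev_conjugate, RCLike.norm_conj]

theorem FReal.continuous_ev (τ : F →+* ℂ) : Continuous (FReal.ev τ) := by
  have h2 : Continuous ((FReal.ev τ).toLinearMap ∘ₗ (FReal.toMixed F).symm.toLinearMap) :=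
    LinearMap.continuous_of_finiteDimensional _
  convert! h2.comp FReal.continuous_toMixed using 1
  ext1 x
  simp

end RealAlgebra

section Angle

/-- The argument of a complex number, normalized to live in `ℝ/ℤ`. -/
noncomputable def cangle (z : ℂ) : RmodZ :=
  AddCircle.equivAddCircle (2 * Real.pi) 1 (by positivity) one_ne_zero (z.arg : Real.Angle)

theorem cangle_mul {z w : ℂ} (hz : z ≠ 0) (hw : w ≠ 0) :
    cangle (z * w) = cangle z + cangle w := by
  rw [cangle, Complex.arg_mul_coe_angle hz hw]
  exact map_add (AddCircle.equivAddCircle (2 * Real.pi) 1 _ _) _ _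

theorem cangle_conj (z : ℂ) : cangle ((starRingEnd ℂ) z) = - cangle z := by
  rw [cangle, Complex.arg_conj_coe_angle]
  exact map_neg (AddCircle.equivAddCircle (2 * Real.pi) 1 _ _) _

theorem cangle_exp (t : ℝ) : cangle (Complex.exp (2 * Real.pi * t * Complex.I)) = (t : RmodZ) := by
  have h : ((Complex.exp (2 * Real.pi * t * Complex.I)).arg : Real.Angle) =
      ((2 * Real.pi * t : ℝ) : Real.Angle) := by
    have := Complex.arg_cos_add_sin_mul_I_coe_angle ((2 * Real.pi * t : ℝ) : Real.Angle)
    rw [← this, Complex.exp_mul_I]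
    simp
  rw [cangle, h]
  refine (AddCircle.equivAddCircle_apply_mk (2 * Real.pi) 1 (by positivity) one_ne_zero _).trans ?_
  congr 1
  field_simp

theorem exp_angle_of_norm_eq_one {z : ℂ} (hz : ‖z‖ = 1) :
    Complex.exp (2 * Real.pi * (z.arg / (2 * Real.pi) : ℝ) * Complex.I) = z := by
  conv_rhs => rw [← Complex.norm_mul_exp_arg_mul_I z, hz]
  have : (Real.pi : ℂ) ≠ 0 := by exact_mod_cast Real.pi_ne_zero
  push_cast
  rw [one_mul]
  congr 1
  field_simp

theorem cangle_one : cangle 1 = 0 := by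
  have := cangle_exp 0
  simpa using this

theorem continuousAt_cangle {z : ℂ} (hz : z ≠ 0) : ContinuousAt cangle z :=
  ((AddCircle.homeomorphAddCircle (2 * Real.pi) 1 (by positivity)
    one_ne_zero).continuous.continuousAt).comp (Complex.continuousAt_arg_coe_angle hz)

end Angle

section Lift

theorem exists_linear_lift {V : Type} [NormedAddCommGroup V] [NormedSpace ℝ V]
    (f : V →+ RmodZ) (hf : Continuous f) : ∃ a : V →ₗ[ℝ] ℝ, ∀ v, f v = (a v : RmodZ) := by
  have : LocallyPathConnectedSpace V := inferInstance
  obtain ⟨g, ⟨hg0, hg⟩, -⟩ := (AddCircle.isCoveringMap_coe (1 : ℝ)).existsUnique_continuousMap_lifts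
    ⟨f, hf⟩ 0 0 (by simp)
  replace hg : ∀ v, (g v : RmodZ) = f v := fun v => congrFun hg v
  have hadd : ∀ v w, g (v + w) = g v + g w := by
    intro v w
    have hc : Continuous fun p : V × V => g (p.1 + p.2) - g p.1 - g p.2 := by fun_prop
    have hz : ∀ p : V × V, ∃ n : ℤ, (n : ℝ) = g (p.1 + p.2) - g p.1 - g p.2 := by
      intro p
      have : ((g (p.1 + p.2) - g p.1 - g p.2 : ℝ) : RmodZ) = 0 := by
        rw [AddCircle.coe_sub, AddCircle.coe_sub, hg, hg, hg, map_add]; abel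
      rw [AddCircle.coe_eq_zero_iff] at this
      obtain ⟨n, hn⟩ := this
      exact ⟨n, by simpa using hn⟩
    choose n hn using hz
    have hnc : Continuous n := by
      rw [Int.isClosedEmbedding_coe_real.continuous_iff]
      exact hc.congr fun p => (hn p).symm
    have := PreconnectedSpace.constant inferInstance hnc (x := (v, w)) (y := (0, 0))
    have h1 := hn (v, w)
    rw [this, hn (0, 0)] at h1
    simp [hg0] at h1
    linarith
  exact ⟨(AddMonoidHom.toRealLinearMap (AddMonoidHom.mk' g hadd) g.continuous).toLinearMap,
    fun v => (hg v).symm⟩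

end Lift

section Characters

variable {F : Type} [Field F] [NumberField F]

/-- The character of `F_ℝˣ` attached to an integral combination of embeddings. -/
noncomputable def embChar (x : (F →+* ℂ) → ℤ) (b : (FReal F)ˣ) : RmodZ :=
  ∑ τ, x τ • cangle (FReal.ev τ b)

theorem FReal.ev_ne_zero (τ : F →+* ℂ) (b : (FReal F)ˣ) : FReal.ev τ b ≠ 0 :=
  (b.isUnit.map (FReal.ev τ)).ne_zero

theorem embChar_mul (x : (F →+* ℂ) → ℤ) (b c : (FReal F)ˣ) :
    embChar x (b * c) = embChar x b + embChar x c := by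
  simp_rw [embChar, Units.val_mul, map_mul,
    cangle_mul (FReal.ev_ne_zero _ b) (FReal.ev_ne_zero _ c), smul_add, Finset.sum_add_distrib]

theorem embChar_add (x y : (F →+* ℂ) → ℤ) (b : (FReal F)ˣ) :
    embChar (x + y) b = embChar x b + embChar y b := by
  simp_rw [embChar, Pi.add_apply, add_smul, Finset.sum_add_distrib]

theorem continuous_embChar (x : (F →+* ℂ) → ℤ) : Continuous (embChar x) := by
  refine continuous_finsetSum _ fun τ _ => Continuous.zsmul ?_ _
  rw [continuous_iff_continuousAt]
  intro b
  exact ContinuousAt.comp (f := fun b : (FReal F)ˣ => FReal.ev τ b)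
    (continuousAt_cangle (FReal.ev_ne_zero τ b))
    ((FReal.continuous_ev τ).comp Units.continuous_val).continuousAt

open scoped Classical in
/-- The exponent with which an integral combination of embeddings acts at an infinite place. -/
noncomputable def placeCoeff (x : (F →+* ℂ) → ℤ) (w : InfinitePlace F) : ℤ :=
  if w.IsReal then x w.embedding
  else x w.embedding - x (ComplexEmbedding.conjugate w.embedding)

theorem embChar_eq_sum_places (x : (F →+* ℂ) → ℤ) (b : (FReal F)ˣ) :
    embChar x b = ∑ w : InfinitePlace F, placeCoeff x w • cangle (FReal.ev w.embedding b) := by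
  classical
  rw [embChar, ← Finset.sum_fiberwise _ (fun φ => InfinitePlace.mk φ)]
  refine Finset.sum_congr rfl fun w _ => ?_
  have hfib : Finset.univ.filter (fun φ : F →+* ℂ => InfinitePlace.mk φ = w) =
      {w.embedding, ComplexEmbedding.conjugate w.embedding} := by
    ext φ
    rw [Finset.mem_filter, Finset.mem_insert, Finset.mem_singleton]
    constructor
    · rintro ⟨-, rfl⟩
      rcases InfinitePlace.embedding_mk_eq φ with h | h
      · exact Or.inl h.symm
      · exact Or.inr (by rw [h]; simp)
    · rintro (rfl | rfl) <;> simp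
  rw [hfib, placeCoeff]
  split_ifs with h
  · rw [(InfinitePlace.conjugate_embedding_eq_of_isReal h)]
    simp
  · rw [Finset.sum_pair, FReal.ev_conjugate, cangle_conj, sub_smul, smul_neg, sub_eq_add_neg]
    intro h'
    exact h (InfinitePlace.isReal_iff.2 h'.symm)

theorem exists_placeCoeff_eq (c : InfinitePlace F → ℤ) : ∃ x, placeCoeff x = c := by
  classical
  refine ⟨fun τ => if τ = (InfinitePlace.mk τ).embedding then c (InfinitePlace.mk τ) else 0, ?_⟩
  funext w
  rw [placeCoeff]
  split_ifs with h1 h2 h3 h4 <;> simp_all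
  exact absurd (InfinitePlace.isReal_iff.2 ‹_›) (InfinitePlace.not_isReal_iff_isComplex.2 ‹_›)

/-- Arguments of elements of absolute value one at all infinite places. -/
def admissibleArgs (F : Type) [Field F] [NumberField F] : AddSubgroup (InfinitePlace F → ℝ) where
  carrier := {s | ∀ w : InfinitePlace F, w.IsReal → ∃ n : ℤ, s w = n / 2}
  zero_mem' w _ := ⟨0, by simp⟩
  add_mem' {s t} hs ht w hw := by
    obtain ⟨n, hn⟩ := hs w hw
    obtain ⟨m, hm⟩ := ht w hw
    exact ⟨n + m, by rw [Pi.add_apply, hn, hm]; push_cast; ring⟩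
  neg_mem' {s} hs w hw := by
    obtain ⟨n, hn⟩ := hs w hw
    exact ⟨-n, by rw [Pi.neg_apply, hn]; push_cast; ring⟩

/-- The element of the mixed space with given arguments. -/
noncomputable def mixedOfArgs (s : InfinitePlace F → ℝ) : mixedEmbedding.mixedSpace F :=
  (fun w => (Complex.exp (2 * Real.pi * s w * Complex.I)).re,
    fun w => Complex.exp (2 * Real.pi * s w * Complex.I))

theorem exp_im_eq_zero (n : ℤ) :
    (Complex.exp (2 * Real.pi * (n / 2 : ℝ) * Complex.I)).im = 0 := by
  have : (2 * Real.pi * (n / 2 : ℝ) * Complex.I : ℂ) = ((n * Real.pi : ℝ) : ℂ) * Complex.I := by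
    push_cast; ring
  rw [this, Complex.exp_ofReal_mul_I_im, Real.sin_int_mul_pi]

theorem mixedOfArgs_add {s : InfinitePlace F → ℝ} (hs : s ∈ admissibleArgs F)
    (t : InfinitePlace F → ℝ) :
    mixedOfArgs (s + t) = mixedOfArgs s * mixedOfArgs t := by
  have key : ∀ w, Complex.exp (2 * Real.pi * ((s + t) w : ℝ) * Complex.I) =
      Complex.exp (2 * Real.pi * s w * Complex.I) * Complex.exp (2 * Real.pi * t w * Complex.I) := by
    intro w
    rw [← Complex.exp_add]
    congr 1
    push_cast [Pi.add_apply]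
    ring
  refine Prod.ext (funext fun w => ?_) (funext fun w => key w)
  obtain ⟨n, hn⟩ := hs w w.2
  change (Complex.exp _).re = (Complex.exp _).re * (Complex.exp _).re
  rw [key, Complex.mul_re, hn, exp_im_eq_zero, zero_mul, sub_zero]

theorem mixedOfArgs_zero : mixedOfArgs (0 : InfinitePlace F → ℝ) = 1 := by
  refine Prod.ext (funext fun w => ?_) (funext fun w => ?_) <;> simp [mixedOfArgs]

/-- The unit of `F_ℝ` with given arguments. -/
noncomputable def unitOfArgs (s : admissibleArgs F) : (FReal F)ˣ where
  val := (FReal.toMixed F).symm (mixedOfArgs s)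
  inv := (FReal.toMixed F).symm (mixedOfArgs (-s : admissibleArgs F))
  val_inv := by
    rw [← map_mul, ← mixedOfArgs_add s.2, ← AddSubgroup.coe_add, add_neg_cancel,
      AddSubgroup.coe_zero, mixedOfArgs_zero, map_one]
  inv_val := by
    rw [← map_mul, ← mixedOfArgs_add (-s).2, ← AddSubgroup.coe_add, neg_add_cancel,
      AddSubgroup.coe_zero, mixedOfArgs_zero, map_one]

theorem unitOfArgs_add (s t : admissibleArgs F) :
    unitOfArgs (s + t) = unitOfArgs s * unitOfArgs t := by
  ext1
  change (FReal.toMixed F).symm _ = (FReal.toMixed F).symm _ * (FReal.toMixed F).symm _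
  rw [← map_mul, ← mixedOfArgs_add s.2, AddSubgroup.coe_add]

theorem ev_unitOfArgs (s : admissibleArgs F) (w : InfinitePlace F) :
    FReal.ev w.embedding (unitOfArgs s : FReal F) =
      Complex.exp (2 * Real.pi * s.1 w * Complex.I) := by
  have h0 : FReal.toMixed F (unitOfArgs s : FReal F) = mixedOfArgs s :=
    (FReal.toMixed F).apply_symm_apply _
  by_cases h : w.IsReal
  · rw [FReal.ev_embedding_of_isReal ⟨w, h⟩, h0]
    obtain ⟨n, hn⟩ := s.2 w h
    apply Complex.ext
    · simp [mixedOfArgs]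
    · rw [hn, exp_im_eq_zero, Complex.ofReal_im]
  · rw [InfinitePlace.not_isReal_iff_isComplex] at h
    rw [FReal.ev_embedding_of_isComplex ⟨w, h⟩, h0]
    rfl

theorem cangle_ev_unitOfArgs (s : admissibleArgs F) (w : InfinitePlace F) :
    cangle (FReal.ev w.embedding (unitOfArgs s : FReal F)) = (s.1 w : RmodZ) := by
  rw [ev_unitOfArgs, cangle_exp]

/-- The units of `F_ℝ` of absolute value one at every infinite place. -/
noncomputable def normOneEverywhere (F : Type) [Field F] [NumberField F] :
    Subgroup (FReal F)ˣ where
  carrier := {u | ∀ w, mixedEmbedding.normAtPlace w (FReal.toMixed F u) = 1}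
  one_mem' w := by simp
  mul_mem' {a b} ha hb w := by simp [ha w, hb w]
  inv_mem' {a} ha w := by
    have h : mixedEmbedding.normAtPlace w (FReal.toMixed F a) *
      mixedEmbedding.normAtPlace w (FReal.toMixed F (a⁻¹ : (FReal F)ˣ)) = 1 := by
      rw [← map_mul, ← map_mul, Units.mul_inv, map_one, map_one]
    simpa [ha w] using h

theorem FReal.ext_ev {b c : FReal F}
    (h : ∀ w : InfinitePlace F, FReal.ev w.embedding b = FReal.ev w.embedding c) : b = c := by
  apply (FReal.toMixed F).injective
  refine Prod.ext (funext fun w => ?_) (funext fun w => ?_)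
  · have := h w.1
    rwa [FReal.ev_embedding_of_isReal, FReal.ev_embedding_of_isReal, Complex.ofReal_inj] at this
  · have := h w.1
    rwa [FReal.ev_embedding_of_isComplex, FReal.ev_embedding_of_isComplex] at this

theorem unitOfArgs_mem (s : admissibleArgs F) : unitOfArgs s ∈ normOneEverywhere F := by
  intro w
  rw [← FReal.norm_ev_embedding, ev_unitOfArgs]
  have : (2 * Real.pi * s.1 w * Complex.I : ℂ) = ((2 * Real.pi * s.1 w : ℝ) : ℂ) * Complex.I := by
    push_cast; ring
  rw [this, Complex.norm_exp_ofReal_mul_I]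

theorem exists_unitOfArgs_eq {u : (FReal F)ˣ} (hu : u ∈ normOneEverywhere F) :
    ∃ s, unitOfArgs s = u := by
  have hn : ∀ w : InfinitePlace F, ‖FReal.ev w.embedding (u : FReal F)‖ = 1 := fun w => by
    rw [FReal.norm_ev_embedding]; exact hu w
  refine ⟨⟨fun w => (FReal.ev w.embedding (u : FReal F)).arg / (2 * Real.pi), fun w hw => ?_⟩, ?_⟩
  · have h1 := hn w
    dsimp only
    rw [FReal.ev_embedding_of_isReal ⟨w, hw⟩] at h1 ⊢
    rw [Complex.norm_real, Real.norm_eq_abs] at h1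
    rcases eq_or_eq_neg_of_abs_eq h1 with h | h <;> rw [h]
    · exact ⟨0, by simp⟩
    · refine ⟨1, ?_⟩
      rw [Complex.ofReal_neg, Complex.ofReal_one, Complex.arg_neg_one]
      have := Real.pi_ne_zero
      field_simp
      simp
  · ext1
    apply FReal.ext_ev
    intro w
    rw [ev_unitOfArgs]
    exact exp_angle_of_norm_eq_one (hn w)

end Characters

section CompactPart

variable {F : Type} [Field F] [NumberField F]

theorem mixedSpace_star_mul_self {z : mixedEmbedding.mixedSpace F}
    (hz : ∀ w, mixedEmbedding.normAtPlace w z = 1) : star z * z = 1 := by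
  refine Prod.ext (funext fun w => ?_) (funext fun w => ?_)
  · have := hz w.1
    rw [mixedEmbedding.normAtPlace_apply_of_isReal w.2] at this
    change star (z.1 w) * z.1 w = 1
    rw [star_trivial, ← abs_mul_abs_self, ← Real.norm_eq_abs, this, one_mul]
  · have := hz w.1
    rw [mixedEmbedding.normAtPlace_apply_of_isComplex w.2] at this
    change star (z.2 w) * z.2 w = 1
    rw [← starRingEnd_apply, Complex.conj_mul', this]
    simp

theorem isCompact_normOneEverywhere :
    IsCompact (normOneEverywhere F : Set (FReal F)ˣ) := by
  classical
  let S : Set (mixedEmbedding.mixedSpace F) := {z | ∀ w, mixedEmbedding.normAtPlace w z = 1}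
  have hS : IsCompact S := by
    refine Metric.isCompact_of_isClosed_isBounded (α := mixedEmbedding.mixedSpace F) (s := S) ?_ ?_
    · have : S = ⋂ w, (mixedEmbedding.normAtPlace w) ⁻¹' {1} := by ext; simp [S]
      rw [this]
      exact isClosed_iInter fun w =>
        isClosed_singleton.preimage (mixedEmbedding.continuous_normAtPlace w)
    · rw [isBounded_iff_forall_norm_le]
      refine ⟨1, fun z hz => ?_⟩
      rw [mixedEmbedding.norm_eq_sup'_normAtPlace]
      exact Finset.sup'_le _ _ fun w _ => (hz w).le
  let f : S → (FReal F)ˣ := fun z =>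
    { val := (FReal.toMixed F).symm z.1
      inv := (FReal.toMixed F).symm (star z.1)
      val_inv := by rw [← map_mul, mul_comm, mixedSpace_star_mul_self z.2, map_one]
      inv_val := by rw [← map_mul, mixedSpace_star_mul_self z.2, map_one] }
  have hf : Continuous f := by
    rw [Units.continuous_iff]
    exact ⟨FReal.continuous_toMixed_symm.comp continuous_subtype_val,
      FReal.continuous_toMixed_symm.comp (continuous_star.comp continuous_subtype_val)⟩
  have := isCompact_iff_compactSpace.1 hS
  convert! isCompact_range hf using 1
  ext u
  constructor
  · intro hu
    exact ⟨⟨FReal.toMixed F u, hu⟩, Units.ext ((FReal.toMixed F).symm_apply_apply _)⟩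
  · rintro ⟨z, rfl⟩ w
    change mixedEmbedding.normAtPlace w (FReal.toMixed F ((FReal.toMixed F).symm z.1)) = 1
    rw [AlgEquiv.apply_symm_apply]
    exact z.2 w

theorem maxCompact_eq : maxCompact F = normOneEverywhere F := by
  refine le_antisymm (sSup_le fun H hH => ?_) (le_sSup isCompact_normOneEverywhere)
  intro u hu w
  let n : (FReal F)ˣ →* ℝ := (mixedEmbedding.normAtPlace w).toMonoidHom.comp
    ((FReal.toMixed F).toRingEquiv.toRingHom.toMonoidHom.comp (Units.coeHom _))
  have hn : Continuous n := (mixedEmbedding.continuous_normAtPlace w).comp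
    (FReal.continuous_toMixed.comp Units.continuous_val)
  obtain ⟨C, hC⟩ := (hH.image hn).bddAbove
  have key : ∀ v ∈ H, n v ≤ 1 := by
    intro v hv
    by_contra! hlt
    obtain ⟨k, hk⟩ := pow_unbounded_of_one_lt C hlt
    have := hC ⟨v ^ k, H.pow_mem hv k, map_pow n v k⟩
    linarith
  have h1 := key u hu
  have h2 := key u⁻¹ (H.inv_mem hu)
  have h3 : n u * n u⁻¹ = 1 := by rw [← map_mul, mul_inv_cancel, map_one]
  have h0 : 0 ≤ n u := mixedEmbedding.normAtPlace_nonneg _ _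
  change n u = 1
  nlinarith

open scoped Classical in
/-- The admissible arguments supported at one infinite place. -/
noncomputable def singleArg (w : InfinitePlace F) (t : ℝ) (ht : w.IsReal → ∃ n : ℤ, t = n / 2) :
    admissibleArgs F :=
  ⟨Pi.single w t, fun v hv => by
    rcases eq_or_ne v w with rfl | h
    · simpa using ht hv
    · exact ⟨0, by simp [h]⟩⟩

theorem embChar_unitOfArgs (x : (F →+* ℂ) → ℤ) (s : admissibleArgs F) :
    embChar x (unitOfArgs s) = ∑ w, placeCoeff x w • (s.1 w : RmodZ) := by
  rw [embChar_eq_sum_places]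
  simp_rw [cangle_ev_unitOfArgs]

theorem embChar_singleArg (x : (F →+* ℂ) → ℤ) (w : InfinitePlace F) (t : ℝ) (ht) :
    embChar x (unitOfArgs (singleArg w t ht)) = placeCoeff x w • (t : RmodZ) := by
  classical
  rw [embChar_unitOfArgs, Finset.sum_eq_single w]
  · simp [singleArg]
  · intro v _ hv
    simp [singleArg, hv]
  · simp

theorem embChar_eq_zero_iff (x : (F →+* ℂ) → ℤ) :
    (∀ u ∈ normOneEverywhere F, embChar x u = 0) ↔
      ∀ w : InfinitePlace F, (w.IsReal → ∃ m : ℤ, placeCoeff x w = 2 * m) ∧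
        (¬ w.IsReal → placeCoeff x w = 0) := by
  constructor
  · intro h w
    have h' := fun t ht => (embChar_singleArg x w t ht).symm.trans (h _ (unitOfArgs_mem _))
    constructor
    · intro hw
      have := h' (1 / 2) fun _ => ⟨1, by simp⟩
      rw [← AddCircle.coe_zsmul, AddCircle.coe_eq_zero_iff] at this
      obtain ⟨n, hn⟩ := this
      refine ⟨n, ?_⟩
      have : (placeCoeff x w : ℝ) = 2 * n := by
        simp only [zsmul_eq_mul, mul_one] at hn; linarith
      exact_mod_cast this
    · intro hw
      by_contra hc
      have := h' (1 / (2 * placeCoeff x w)) fun h => absurd h hw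
      rw [← AddCircle.coe_zsmul, AddCircle.coe_eq_zero_iff] at this
      obtain ⟨n, hn⟩ := this
      have hc' : (placeCoeff x w : ℝ) ≠ 0 := by exact_mod_cast hc
      simp only [zsmul_eq_mul, mul_one] at hn
      field_simp at hn
      have : n * 2 = 1 := by exact_mod_cast hn
      omega
  · intro h u hu
    obtain ⟨s, rfl⟩ := exists_unitOfArgs_eq hu
    rw [embChar_unitOfArgs]
    refine Finset.sum_eq_zero fun w _ => ?_
    by_cases hw : w.IsReal
    · obtain ⟨m, hm⟩ := (h w).1 hw
      obtain ⟨n, hn⟩ := s.2 w hw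
      rw [hm, hn, ← AddCircle.coe_zsmul, AddCircle.coe_eq_zero_iff]
      exact ⟨m * n, by simp; ring⟩
    · rw [(h w).2 hw, zero_smul]

theorem singleArg_add (w : InfinitePlace F) (t t' : ℝ) (ht) (ht') (h) :
    singleArg w (t + t') h = singleArg w t ht + singleArg w t' ht' := by
  classical
  apply Subtype.ext
  exact Pi.single_add (f := fun _ => ℝ) w t t'

theorem continuous_unitOfArgs : Continuous (unitOfArgs (F := F)) := by
  have h : Continuous (mixedOfArgs (F := F)) := by
    unfold mixedOfArgs
    refine Continuous.prodMk (continuous_pi fun w => ?_) (continuous_pi fun w => ?_)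
    · exact Complex.continuous_re.comp (by fun_prop)
    · fun_prop
  rw [Units.continuous_iff]
  exact ⟨FReal.continuous_toMixed_symm.comp (h.comp continuous_subtype_val),
    FReal.continuous_toMixed_symm.comp (h.comp (continuous_subtype_val.comp continuous_neg))⟩

/-- Every continuous character of the compact part is a combination of embeddings. -/
theorem exists_embChar_eq (ψ : (FReal F)ˣ → RmodZ)
    (hmul : ∀ u ∈ normOneEverywhere F, ∀ v ∈ normOneEverywhere F, ψ (u * v) = ψ u + ψ v)
    (hcont : ContinuousOn ψ (normOneEverywhere F)) :
    ∃ x, ∀ u ∈ normOneEverywhere F, ψ u = embChar x u := by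
  classical
  have hadd : ∀ s t, ψ (unitOfArgs (s + t)) = ψ (unitOfArgs s) + ψ (unitOfArgs t) :=
    fun s t => by rw [unitOfArgs_add, hmul _ (unitOfArgs_mem s) _ (unitOfArgs_mem t)]
  let f : admissibleArgs F →+ RmodZ := AddMonoidHom.mk' (fun s => ψ (unitOfArgs s)) hadd
  have hfc : Continuous f := hcont.comp_continuous continuous_unitOfArgs unitOfArgs_mem
  have f_int : ∀ s : admissibleArgs F, (∀ w, ∃ n : ℤ, s.1 w = n) → f s = 0 := by
    intro s hs
    have h1 : unitOfArgs s = 1 := by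
      ext1
      apply FReal.ext_ev
      intro w
      obtain ⟨n, hn⟩ := hs w
      rw [ev_unitOfArgs, hn, Units.val_one, map_one, Complex.exp_eq_one_iff]
      exact ⟨n, by push_cast; ring⟩
    have h2 : unitOfArgs (0 : admissibleArgs F) = 1 := by
      have := unitOfArgs_add (0 : admissibleArgs F) 0
      rw [add_zero] at this
      exact left_eq_mul.1 this
    rw [← map_zero f]
    change ψ _ = ψ _
    rw [h1, h2]
  have single_int : ∀ (w : InfinitePlace F) (t : ℤ) (ht), f (singleArg w t ht) = 0 := by
    intro w t ht
    refine f_int _ fun v => ?_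
    rcases eq_or_ne v w with rfl | h
    · exact ⟨t, by simp [singleArg]⟩
    · exact ⟨0, by simp [singleArg, h]⟩
  have hplace : ∀ w : InfinitePlace F, ∃ c : ℤ, ∀ t ht, f (singleArg w t ht) = c • (t : RmodZ) := by
    intro w
    by_cases hw : w.IsReal
    · have hhalf : ∀ n : ℤ, w.IsReal → ∃ m : ℤ, (n / 2 : ℝ) = m / 2 := fun n _ => ⟨n, rfl⟩
      let h : ℤ →+ RmodZ := AddMonoidHom.mk' (fun n => f (singleArg w (n / 2) (hhalf n)))
        (fun a b => by
          rw [← map_add, ← singleArg_add w _ _ _ _ (fun _ => ⟨a + b, by push_cast; ring⟩)]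
          congr 2
          push_cast; ring)
      have h2 : (2 : ℤ) • h 1 = 0 := by
        rw [← map_zsmul]
        change f (singleArg w (((2 : ℤ) • (1 : ℤ) : ℤ) / 2 : ℝ) _) = 0
        rw [← single_int w 1 (fun _ => ⟨2, by simp⟩)]
        congr 2
        simp
      obtain ⟨c, hc⟩ : ∃ c : ℤ, h 1 = c • ((1 / 2 : ℝ) : RmodZ) := by
        obtain ⟨r, hr⟩ := QuotientAddGroup.mk_surjective (h 1)
        replace hr : (r : RmodZ) = h 1 := hr
        rw [← hr, ← AddCircle.coe_zsmul, AddCircle.coe_eq_zero_iff] at h2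
        obtain ⟨n, hn⟩ := h2
        refine ⟨n, ?_⟩
        rw [← hr, ← AddCircle.coe_zsmul]
        congr 1
        simp at hn ⊢
        linarith
      refine ⟨c, fun t ht => ?_⟩
      obtain ⟨n, rfl⟩ := ht hw
      have : h n = n • h 1 := by rw [← map_zsmul]; simp
      change h n = _
      rw [this, hc, smul_comm]
      congr 1
      rw [← AddCircle.coe_zsmul]
      congr 1
      simp; ring
    · have htriv : ∀ t : ℝ, w.IsReal → ∃ m : ℤ, t = m / 2 := fun t h => absurd h hw
      let h : ℝ →+ RmodZ := AddMonoidHom.mk' (fun t => f (singleArg w t (htriv t)))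
        (fun a b => by rw [← map_add, ← singleArg_add])
      have hc : Continuous h := by
        refine hfc.comp (Continuous.subtype_mk (f := fun t : ℝ => Pi.single (M := fun _ : InfinitePlace F => ℝ) w t) ?_ _)
        exact continuous_single (A := fun _ : InfinitePlace F => ℝ) w
      obtain ⟨a, ha⟩ := exists_linear_lift h hc
      have h1 : (a 1 : RmodZ) = 0 := by
        rw [← ha, ← single_int w 1 (fun h => absurd h hw)]
        change f _ = _
        congr 2
        simp
      rw [AddCircle.coe_eq_zero_iff] at h1
      obtain ⟨c, hc⟩ := h1
      refine ⟨c, fun t ht => ?_⟩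
      change h t = _
      rw [ha, ← AddCircle.coe_zsmul]
      congr 1
      have : a t = t * a 1 := by rw [← smul_eq_mul, ← map_smul]; simp
      rw [this, ← hc]
      simp; ring
  choose c hc using hplace
  obtain ⟨x, hx⟩ := exists_placeCoeff_eq c
  refine ⟨x, fun u hu => ?_⟩
  obtain ⟨s, rfl⟩ := exists_unitOfArgs_eq hu
  rw [embChar_unitOfArgs, hx]
  have hs : s = ∑ w, singleArg w (s.1 w) (s.2 w) := by
    apply Subtype.ext
    rw [AddSubgroup.val_finsetSum]
    exact (Finset.univ_sum_single s.1).symm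
  change f s = _
  conv_lhs => rw [hs]
  rw [map_sum]
  exact Finset.sum_congr rfl fun w _ => hc w _ _

end CompactPart

section Divisors

variable {F : Type} [Field F] [NumberField F]

instance : ContinuousMul (FReal F) where
  continuous_mul := by
    have : Continuous fun p : FReal F × FReal F => (FReal.toMixed F).symm
        (FReal.toMixed F p.1 * FReal.toMixed F p.2) :=
      FReal.continuous_toMixed_symm.comp
        ((FReal.continuous_toMixed.comp continuous_fst).mul
          (FReal.continuous_toMixed.comp continuous_snd))
    simpa using this

instance : DiscreteTopology (IdealGroup F) := ⟨rfl⟩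

instance : IsTopologicalGroup (PicTilde F) :=
  inferInstanceAs (IsTopologicalGroup (picDom F ⧸ principalSub F))

instance : IsTopologicalGroup (PicZero F) :=
  inferInstanceAs (IsTopologicalGroup (PicTilde F ⧸ compImage F))

theorem mem_picDom {p : IdealGroup F × (FReal F)ˣ} : p ∈ picDom F ↔
    ((FractionalIdeal.absNorm (p.1 : FractionalIdeal (𝓞 F)⁰ F) : ℚ) : ℝ) =
      mixedEmbedding.norm (FReal.toMixed F p.2) := by
  rw [picDom, MonoidHom.mem_ker, MonoidHom.div_apply, div_eq_one, Units.ext_iff,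
    ← FReal.abs_norm_eq]
  rfl

/-- The kernel of the absolute norm on `F_ℝˣ`. -/
noncomputable def normOne (F : Type) [Field F] [NumberField F] : Subgroup (FReal F)ˣ :=
  (absNormFR F).ker

theorem mem_normOne {b : (FReal F)ˣ} :
    b ∈ normOne F ↔ mixedEmbedding.norm (FReal.toMixed F b) = 1 := by
  rw [normOne, MonoidHom.mem_ker, Units.ext_iff, ← FReal.abs_norm_eq]
  rfl

theorem normOneEverywhere_le : normOneEverywhere F ≤ normOne F := by
  intro u hu
  rw [mem_normOne, mixedEmbedding.norm_apply]
  exact Finset.prod_eq_one fun w _ => by rw [hu w, one_pow]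

/-- The inclusion `b ↦ (1, b)` into the group of oriented Arakelov divisors. -/
noncomputable def infiniteDivisor (F : Type) [Field F] [NumberField F] : normOne F →* picDom F :=
  ((MonoidHom.inr _ _).comp (normOne F).subtype).codRestrict (picDom F) fun b => by
    rw [mem_picDom]
    simpa using (mem_normOne.1 b.2).symm

@[simp]
theorem coe_infiniteDivisor (b : normOne F) :
    (infiniteDivisor F b : IdealGroup F × (FReal F)ˣ) = (1, (b : (FReal F)ˣ)) := rfl

theorem continuous_infiniteDivisor : Continuous (infiniteDivisor F) :=
  Continuous.subtype_mk (continuous_const.prodMk continuous_subtype_val) _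

theorem continuous_mk : Continuous (PicTilde.mk F) := continuous_quotient_mk'

theorem continuous_mkZero : Continuous (PicZero.mk F) :=
  (continuous_quotient_mk' (s := QuotientGroup.leftRel (compImage F))).comp continuous_mk

/-- The image of an element of `Fˣ` in `F_ℝˣ`. -/
noncomputable def unitTmul (F : Type) [Field F] [NumberField F] : Fˣ →* (FReal F)ˣ :=
  Units.map (Algebra.TensorProduct.includeRight : F →ₐ[ℚ] FReal F).toMonoidHom

theorem coe_unitTmul (a : Fˣ) : (unitTmul F a : FReal F) = 1 ⊗ₜ (a : F) := rfl

theorem toMixed_unitTmul (a : Fˣ) : FReal.toMixed F (unitTmul F a) = mixedEmbedding F a := by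
  rw [coe_unitTmul, FReal.toMixed_tmul, one_smul]

theorem principalHom_mem (a : Fˣ) : principalHom F a ∈ picDom F := by
  rw [mem_picDom]
  change ((FractionalIdeal.absNorm ((toPrincipalIdeal (𝓞 F) F a : IdealGroup F) :
    FractionalIdeal (𝓞 F)⁰ F) : ℚ) : ℝ) = mixedEmbedding.norm (FReal.toMixed F (unitTmul F a))
  rw [toMixed_unitTmul, mixedEmbedding.norm_eq_norm, coe_toPrincipalIdeal,
    FractionalIdeal.absNorm_span_singleton]

theorem mk_eq_mk_iff {p q : picDom F} : PicTilde.mk F p = PicTilde.mk F q ↔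
    ∃ a : Fˣ, principalHom F a = (p : IdealGroup F × (FReal F)ˣ)⁻¹ * q := by
  rw [PicTilde.mk]
  exact QuotientGroup.eq

theorem mk_one : PicTilde.mk F 1 = 1 := rfl

theorem mkZero_mul (p q : picDom F) :
    PicZero.mk F (p * q) = PicZero.mk F p * PicZero.mk F q := rfl

theorem toPrincipalIdeal_eq_one_iff {a : Fˣ} :
    toPrincipalIdeal (𝓞 F) F a = 1 ↔ ∃ e : (𝓞 F)ˣ, ((e : 𝓞 F) : F) = a := by
  rw [toPrincipalIdeal_eq_iff]
  constructor
  · intro h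
    have h1 : (a : F) ∈ (1 : FractionalIdeal (𝓞 F)⁰ F) := by
      rw [← Units.val_one (α := FractionalIdeal (𝓞 F)⁰ F), ← h]
      exact FractionalIdeal.mem_spanSingleton_self _ _
    have h2 : (1 : F) ∈ FractionalIdeal.spanSingleton (𝓞 F)⁰ (a : F) := by
      rw [h]
      exact FractionalIdeal.one_mem_one _
    obtain ⟨y, hy⟩ := (FractionalIdeal.mem_one_iff _).1 h1
    obtain ⟨z, hz⟩ := (FractionalIdeal.mem_spanSingleton _).1 h2
    have hyz : y * z = 1 := by
      apply FaithfulSMul.algebraMap_injective (𝓞 F) F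
      rw [map_mul, hy, map_one, mul_comm, ← Algebra.smul_def, hz]
    exact ⟨⟨y, z, hyz, by rw [mul_comm, hyz]⟩, hy⟩
  · rintro ⟨e, he⟩
    rw [← he]
    refine le_antisymm ?_ ?_
    · rw [FractionalIdeal.spanSingleton_le_iff_mem]
      exact FractionalIdeal.coe_mem_one _ _
    · intro x hx
      obtain ⟨y, rfl⟩ := (FractionalIdeal.mem_one_iff _).1 hx
      refine (FractionalIdeal.mem_spanSingleton _).2 ⟨y * ((e⁻¹ : (𝓞 F)ˣ) : 𝓞 F), ?_⟩
      rw [Algebra.smul_def, ← map_mul, mul_assoc, Units.inv_mul, mul_one]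

theorem mk_infiniteDivisor_eq_one_iff (b : normOne F) :
    PicTilde.mk F (infiniteDivisor F b) = 1 ↔
      ∃ e : (𝓞 F)ˣ, (b : (FReal F)ˣ) = unitTmul F (Units.map (algebraMap (𝓞 F) F).toMonoidHom e) := by
  rw [← mk_one, eq_comm, mk_eq_mk_iff]
  constructor
  · rintro ⟨a, ha⟩
    obtain ⟨h1, h2⟩ := Prod.ext_iff.1 ha
    obtain ⟨e, he⟩ := toPrincipalIdeal_eq_one_iff.1 (h1.trans (by simp))
    refine ⟨e, ?_⟩
    have : Units.map (algebraMap (𝓞 F) F).toMonoidHom e = a := Units.ext he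
    rw [this]
    refine Eq.trans ?_ h2.symm
    simp
  · rintro ⟨e, he⟩
    refine ⟨Units.map (algebraMap (𝓞 F) F).toMonoidHom e, Prod.ext ?_ ?_⟩
    · exact (toPrincipalIdeal_eq_one_iff.2 ⟨e, rfl⟩).trans (by simp)
    · exact he.symm.trans (by simp)

instance : IsTopologicalGroup (picDom F) := inferInstance

theorem continuous_of_infiniteDivisor (f : Additive (PicTilde F) →+ RmodZ)
    (ψ : (FReal F)ˣ → RmodZ) (hψ : Continuous ψ)
    (h : ∀ b : normOne F, f (Additive.ofMul (PicTilde.mk F (infiniteDivisor F b))) = ψ b) :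
    Continuous f := by
  let f' : Additive (picDom F) →+ RmodZ :=
    f.comp (MonoidHom.toAdditive (QuotientGroup.mk' (principalSub F)))
  have hf' : Continuous f' := by
    refine continuous_of_continuousAt_zero f' ?_
    have hc : ContinuousAt (fun p : picDom F => ψ (p : IdealGroup F × (FReal F)ˣ).2) 1 :=
      (hψ.comp (continuous_snd.comp continuous_subtype_val)).continuousAt
    have ho : IsOpen {p : picDom F | (p : IdealGroup F × (FReal F)ˣ).1 = 1} :=
      (isOpen_discrete {(1 : IdealGroup F)}).preimage (continuous_fst.comp continuous_subtype_val)
    refine ContinuousAt.congr (f := fun p : picDom F => ψ (p : IdealGroup F × (FReal F)ˣ).2) hc ?_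
    filter_upwards [ho.mem_nhds (show (1 : picDom F) ∈ _ from rfl)] with p hp
    have hb : (p : IdealGroup F × (FReal F)ˣ).2 ∈ normOne F := by
      have := mem_picDom.1 p.2
      rw [show (p : IdealGroup F × (FReal F)ˣ).1 = 1 from hp] at this
      rw [mem_normOne, ← this]
      simp
    have hp' : p = infiniteDivisor F ⟨_, hb⟩ := Subtype.ext (Prod.ext hp rfl)
    refine (h ⟨_, hb⟩).symm.trans ?_
    rw [← hp']
    rfl
  exact (QuotientGroup.isQuotientMap_mk (N := principalSub F)).continuous_iff.2 hf'

theorem exists_addMonoidHom_factor {A B Q : Type} [AddCommGroup A] [AddCommGroup B]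
    [AddCommGroup Q] [DivisibleBy Q ℤ] (i : A →+ B) (f : A →+ Q)
    (h : ∀ a, i a = 0 → f a = 0) : ∃ g : B →+ Q, ∀ a, g (i a) = f a := by
  have hle : i.ker ≤ f.ker := fun a ha => h a ha
  obtain ⟨g, hg⟩ := (Module.Baer.of_divisible Q).extension_property_addMonoidHom
    (QuotientAddGroup.kerLift i) (QuotientAddGroup.kerLift_injective i)
    (QuotientAddGroup.lift i.ker f hle)
  exact ⟨g, fun a => DFunLike.congr_fun hg (a : A ⧸ i.ker)⟩

/-- A continuous character of `F_ℝˣ` that is trivial on the units of `F` extends, after restriction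
to elements of norm one, to the oriented Arakelov class group. -/
theorem exists_arTilde_extension (ψ : (FReal F)ˣ → RmodZ) (hψ : Continuous ψ)
    (hmul : ∀ u v, ψ (u * v) = ψ u + ψ v)
    (hunit : ∀ e : (𝓞 F)ˣ, ψ (unitTmul F (Units.map (algebraMap (𝓞 F) F).toMonoidHom e)) = 0) :
    ∃ φ : ArTilde F, ∀ b : normOne F,
      φ (Additive.ofMul (PicTilde.mk F (infiniteDivisor F b))) = ψ b := by
  let i : Additive (normOne F) →+ Additive (PicTilde F) :=
    MonoidHom.toAdditive ((QuotientGroup.mk' (principalSub F)).comp (infiniteDivisor F))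
  let f : Additive (normOne F) →+ RmodZ :=
    AddMonoidHom.mk' (fun b => ψ (b.toMul : (FReal F)ˣ)) fun a b => hmul _ _
  obtain ⟨g, hg⟩ := exists_addMonoidHom_factor i f fun a ha => by
    obtain ⟨e, he⟩ := (mk_infiniteDivisor_eq_one_iff a.toMul).1 ha
    change ψ (a.toMul : (FReal F)ˣ) = 0
    rw [he, hunit]
  exact ⟨⟨g, continuous_of_infiniteDivisor g ψ hψ fun b => hg (Additive.ofMul b)⟩,
    fun b => hg (Additive.ofMul b)⟩

/-- The logarithmic embedding of `F_ℝˣ`, omitting one place. -/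
noncomputable def realLog (b : (FReal F)ˣ) : Units.dirichletUnitTheorem.logSpace F := fun w =>
  w.1.mult * Real.log (mixedEmbedding.normAtPlace w.1 (FReal.toMixed F b))

theorem normAtPlace_ne_zero (b : (FReal F)ˣ) (w : InfinitePlace F) :
    mixedEmbedding.normAtPlace w (FReal.toMixed F b) ≠ 0 := by
  rw [← FReal.norm_ev_embedding]
  exact norm_ne_zero_iff.2 (FReal.ev_ne_zero _ _)

theorem realLog_mul (b c : (FReal F)ˣ) : realLog (b * c) = realLog b + realLog c := by
  funext w
  simp only [realLog, Units.val_mul, map_mul, Pi.add_apply]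
  rw [Real.log_mul (normAtPlace_ne_zero _ _) (normAtPlace_ne_zero _ _), mul_add]

theorem continuous_realLog : Continuous (realLog (F := F)) :=
  continuous_pi fun w => continuous_const.mul
    (((mixedEmbedding.continuous_normAtPlace w.1).comp
      (FReal.continuous_toMixed.comp Units.continuous_val)).log fun b => normAtPlace_ne_zero b _)

theorem realLog_normOneEverywhere {u : (FReal F)ˣ} (hu : u ∈ normOneEverywhere F) :
    realLog u = 0 := by
  funext w
  simp [realLog, hu w.1]

theorem realLog_unit (e : (𝓞 F)ˣ) :
    realLog (unitTmul F (Units.map (algebraMap (𝓞 F) F).toMonoidHom e)) =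
      Units.logEmbedding F (Additive.ofMul e) := by
  funext w
  rw [Units.dirichletUnitTheorem.logEmbedding_component, realLog, toMixed_unitTmul,
    mixedEmbedding.normAtPlace_apply]
  rfl

/-- The character of the unit group attached to `x`. -/
noncomputable def unitChar (x : (F →+* ℂ) → ℤ) : Additive (𝓞 F)ˣ →+ RmodZ :=
  AddMonoidHom.mk' (fun e => embChar x
      (unitTmul F (Units.map (algebraMap (𝓞 F) F).toMonoidHom e.toMul))) fun a b => by
    rw [toMul_add, map_mul, map_mul, embChar_mul]

theorem exists_linear_unitChar (x : (F →+* ℂ) → ℤ)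
    (hx : ∀ z : CommGroup.torsion Fˣ, embChar x (unitTmul F z) = 0) :
    ∃ l : Units.dirichletUnitTheorem.logSpace F →ₗ[ℝ] ℝ, ∀ e : (𝓞 F)ˣ,
      unitChar x (Additive.ofMul e) = (l (Units.logEmbedding F (Additive.ofMul e)) : RmodZ) := by
  classical
  choose t ht using fun i => QuotientAddGroup.mk_surjective
    (unitChar x (Additive.ofMul (Units.fundSystem F i)))
  let B := (Units.basisUnitLattice F).ofZLatticeBasis ℝ (Units.unitLattice F)
  let l : Units.dirichletUnitTheorem.logSpace F →ₗ[ℝ] ℝ := B.constr ℝ t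
  refine ⟨l, fun e => ?_⟩
  let f2 : Additive (𝓞 F)ˣ →+ RmodZ := (QuotientAddGroup.mk' _).comp
    (l.toAddMonoidHom.comp (Units.logEmbedding F))
  obtain ⟨⟨z, n⟩, he, -⟩ := Units.exist_unique_eq_mul_prod F e
  have h2 : ∀ i, f2 (Additive.ofMul (Units.fundSystem F i)) =
      unitChar x (Additive.ofMul (Units.fundSystem F i)) := fun i => by
    rw [← ht]
    change ((l (Units.logEmbedding F (Additive.ofMul (Units.fundSystem F i))) : ℝ) : RmodZ) = t i
    rw [Units.logEmbedding_fundSystem]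
    have : ((Units.basisUnitLattice F i : Units.unitLattice F) : Units.dirichletUnitTheorem.logSpace F) = B i := by
      rw [Module.Basis.ofZLatticeBasis_apply]
    rw [this, Module.Basis.constr_basis]
  have hz1 : unitChar x (Additive.ofMul (z : (𝓞 F)ˣ)) = 0 :=
    hx ⟨Units.map (algebraMap (𝓞 F) F).toMonoidHom z, MonoidHom.isOfFinOrder _ z.2⟩
  have hz2 : f2 (Additive.ofMul (z : (𝓞 F)ˣ)) = 0 := by
    change ((l (Units.logEmbedding F (Additive.ofMul (z : (𝓞 F)ˣ))) : ℝ) : RmodZ) = 0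
    rw [Units.dirichletUnitTheorem.logEmbedding_eq_zero_iff.2 z.2, map_zero]
    rfl
  change unitChar x (Additive.ofMul e) = f2 (Additive.ofMul e)
  rw [he, ofMul_mul, map_add, map_add, hz1, hz2, ofMul_prod, map_sum, map_sum]
  simp only [ofMul_zpow, map_zsmul, h2]

theorem exists_arTilde_of_embChar (x : (F →+* ℂ) → ℤ)
    (hx : ∀ z : CommGroup.torsion Fˣ, embChar x (unitTmul F z) = 0) :
    ∃ φ : ArTilde F, ∀ b : normOne F, (b : (FReal F)ˣ) ∈ normOneEverywhere F →
      φ (Additive.ofMul (PicTilde.mk F (infiniteDivisor F b))) = embChar x b := by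
  obtain ⟨l, hl⟩ := exists_linear_unitChar x hx
  have hcl : Continuous l := LinearMap.continuous_of_finiteDimensional l
  obtain ⟨φ, hφ⟩ := exists_arTilde_extension (fun b => embChar x b - (l (realLog b) : RmodZ))
    ((continuous_embChar x).sub ((AddCircle.continuous_mk' 1).comp (hcl.comp continuous_realLog)))
    (fun u v => by
      rw [embChar_mul, realLog_mul, map_add, AddCircle.coe_add]
      abel)
    fun e => by
      rw [realLog_unit, ← hl, sub_eq_zero]
      rfl
  refine ⟨φ, fun b hb => (hφ b).trans ?_⟩
  rw [realLog_normOneEverywhere hb, map_zero]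
  exact sub_zero _

end Divisors

section FiniteGeneration

variable {F : Type} [Field F] [NumberField F]

/-- The totally positive element of `F_ℝ` with prescribed logarithms. -/
noncomputable def mixedExp (c : InfinitePlace F → ℝ) : mixedEmbedding.mixedSpace F :=
  (fun w => Real.exp (c w.1), fun w => (Real.exp (c w.1) : ℂ))

theorem mixedExp_add (c d : InfinitePlace F → ℝ) :
    mixedExp (c + d) = mixedExp c * mixedExp d := by
  refine Prod.ext ?_ ?_ <;> funext w <;> simp [mixedExp, Real.exp_add]

theorem mixedExp_zero : mixedExp (0 : InfinitePlace F → ℝ) = 1 := by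
  refine Prod.ext ?_ ?_ <;> funext w <;> simp [mixedExp]

theorem normAtPlace_mixedExp (c : InfinitePlace F → ℝ) (w : InfinitePlace F) :
    mixedEmbedding.normAtPlace w (mixedExp c) = Real.exp (c w) := by
  by_cases hw : w.IsReal
  · rw [mixedEmbedding.normAtPlace_apply_of_isReal hw]
    simp [mixedExp]
  · rw [mixedEmbedding.normAtPlace_apply_of_isComplex (InfinitePlace.not_isReal_iff_isComplex.1 hw)]
    simp [mixedExp, Complex.norm_exp]

theorem continuous_mixedExp : Continuous (mixedExp (F := F)) := by
  unfold mixedExp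
  fun_prop

/-- The unit of `F_ℝ` with prescribed logarithms. -/
noncomputable def expUnit (c : InfinitePlace F → ℝ) : (FReal F)ˣ where
  val := (FReal.toMixed F).symm (mixedExp c)
  inv := (FReal.toMixed F).symm (mixedExp (-c))
  val_inv := by rw [← map_mul, ← mixedExp_add, add_neg_cancel, mixedExp_zero, map_one]
  inv_val := by rw [← map_mul, ← mixedExp_add, neg_add_cancel, mixedExp_zero, map_one]

theorem expUnit_add (c d : InfinitePlace F → ℝ) : expUnit (c + d) = expUnit c * expUnit d :=
  Units.ext (by simp [expUnit, mixedExp_add])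

theorem continuous_expUnit : Continuous (expUnit (F := F)) :=
  Units.continuous_iff.2 ⟨FReal.continuous_toMixed_symm.comp continuous_mixedExp,
    FReal.continuous_toMixed_symm.comp (continuous_mixedExp.comp continuous_neg)⟩

theorem normAtPlace_expUnit (c : InfinitePlace F → ℝ) (w : InfinitePlace F) :
    mixedEmbedding.normAtPlace w (FReal.toMixed F (expUnit c)) = Real.exp (c w) := by
  rw [← normAtPlace_mixedExp]
  simp [expUnit]

open Units.dirichletUnitTheorem in
open scoped Classical in
/-- The logarithms of the element of norm one with image `v` in the logarithmic space. -/
noncomputable def logArgs (v : logSpace F) (w : InfinitePlace F) : ℝ :=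
  if h : w = w₀ then -(∑ w', v w') / w.mult else v ⟨w, h⟩ / w.mult

theorem logArgs_add (v v' : Units.dirichletUnitTheorem.logSpace F) :
    logArgs (v + v') = logArgs v + logArgs v' := by
  funext w
  simp only [logArgs, Pi.add_apply]
  split_ifs
  · rw [Finset.sum_add_distrib]
    ring
  · ring

theorem continuous_logArgs : Continuous (logArgs (F := F)) := by
  refine continuous_pi fun w => ?_
  unfold logArgs
  split_ifs <;> fun_prop

theorem sum_mult_mul_logArgs (v : Units.dirichletUnitTheorem.logSpace F) :
    ∑ w, (w.mult : ℝ) * logArgs v w = 0 := by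
  classical
  have hm : ∀ w : InfinitePlace F, (w.mult : ℝ) ≠ 0 := fun w => InfinitePlace.mult_coe_ne_zero
  rw [Fintype.sum_eq_add_sum_subtype_ne _ (Units.dirichletUnitTheorem.w₀ : InfinitePlace F)]
  rw [Finset.sum_congr rfl fun (w : {w // w ≠ Units.dirichletUnitTheorem.w₀}) _ =>
    show (w.1.mult : ℝ) * logArgs v w.1 = v w by
      rw [logArgs, dif_neg w.2, mul_div_cancel₀ _ (hm _)]]
  rw [logArgs, dif_pos rfl, mul_div_cancel₀ _ (hm _)]
  exact neg_add_cancel _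

theorem norm_expUnit_logArgs (v : Units.dirichletUnitTheorem.logSpace F) :
    expUnit (logArgs v) ∈ normOne F := by
  rw [mem_normOne, mixedEmbedding.norm_apply]
  simp_rw [normAtPlace_expUnit, ← Real.exp_nat_mul]
  rw [← Real.exp_sum, sum_mult_mul_logArgs, Real.exp_zero]

/-- A continuous section of the logarithm on elements of norm one. -/
noncomputable def logSection (v : Units.dirichletUnitTheorem.logSpace F) : normOne F :=
  ⟨expUnit (logArgs v), norm_expUnit_logArgs v⟩

theorem logSection_add (v v' : Units.dirichletUnitTheorem.logSpace F) :
    logSection (v + v') = logSection v * logSection v' :=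
  Subtype.ext (by simp [logSection, logArgs_add, expUnit_add])

theorem continuous_logSection : Continuous (logSection (F := F)) :=
  (continuous_expUnit.comp continuous_logArgs).subtype_mk _

theorem realLog_logSection (v : Units.dirichletUnitTheorem.logSpace F) :
    realLog (logSection v : (FReal F)ˣ) = v := by
  funext w
  have hm : (w.1.mult : ℝ) ≠ 0 := InfinitePlace.mult_coe_ne_zero
  rw [realLog, logSection, normAtPlace_expUnit, Real.log_exp, logArgs, dif_neg w.2,
    mul_div_cancel₀ _ hm]

theorem mem_normOneEverywhere_of_realLog_eq_zero {b : (FReal F)ˣ} (hb : b ∈ normOne F)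
    (h : realLog b = 0) : b ∈ normOneEverywhere F := by
  classical
  have h1 : ∀ w : InfinitePlace F, w ≠ Units.dirichletUnitTheorem.w₀ →
      mixedEmbedding.normAtPlace w (FReal.toMixed F b) = 1 := fun w hw => by
    have hm : (w.mult : ℝ) ≠ 0 := InfinitePlace.mult_coe_ne_zero
    have h2 := congrFun h ⟨w, hw⟩
    have h3 := (mul_eq_zero.1 h2).resolve_left hm
    exact Real.eq_one_of_pos_of_log_eq_zero
      (lt_of_le_of_ne (mixedEmbedding.normAtPlace_nonneg _ _) (normAtPlace_ne_zero b w).symm) h3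
  intro w
  by_cases hw : w = Units.dirichletUnitTheorem.w₀
  · have h2 := mem_normOne.1 hb
    rw [mixedEmbedding.norm_apply, Finset.prod_eq_single w] at h2
    · exact (pow_eq_one_iff_of_nonneg (mixedEmbedding.normAtPlace_nonneg _ _)
        w.mult_ne_zero).1 h2
    · intro w' _ hw'
      rw [h1 w' (hw ▸ hw'), one_pow]
    · simp
  · exact h1 w hw

theorem mkZero_infiniteDivisor_eq_one {b : normOne F}
    (hb : (b : (FReal F)ˣ) ∈ normOneEverywhere F) :
    PicZero.mk F (infiniteDivisor F b) = 1 := by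
  refine (QuotientGroup.eq_one_iff _).2 ⟨infiniteDivisor F b, ?_, rfl⟩
  refine ⟨rfl, ?_⟩
  rw [maxCompact_eq]
  exact hb

theorem mkZero_eq_of_realLog_eq {b c : normOne F}
    (h : realLog (b : (FReal F)ˣ) = realLog (c : (FReal F)ˣ)) :
    PicZero.mk F (infiniteDivisor F b) = PicZero.mk F (infiniteDivisor F c) := by
  have h1 : ((b * c⁻¹ : normOne F) : (FReal F)ˣ) ∈ normOneEverywhere F := by
    refine mem_normOneEverywhere_of_realLog_eq_zero (b * c⁻¹).2 ?_
    have h2 := realLog_mul ((b * c⁻¹ : normOne F) : (FReal F)ˣ) c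
    rw [← Subgroup.coe_mul, inv_mul_cancel_right, h] at h2
    exact right_eq_add.1 h2
  have h2 := mkZero_mul (infiniteDivisor F (b * c⁻¹)) (infiniteDivisor F c)
  rw [mkZero_infiniteDivisor_eq_one h1, one_mul, ← map_mul, inv_mul_cancel_right] at h2
  exact h2

theorem mkZero_of_mk_eq_one {p : picDom F} (h : PicTilde.mk F p = 1) : PicZero.mk F p = 1 := by
  rw [PicZero.mk, h]
  rfl

theorem unitTmul_unit_mem (e : (𝓞 F)ˣ) :
    unitTmul F (Units.map (algebraMap (𝓞 F) F).toMonoidHom e) ∈ normOne F := by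
  have h := mem_picDom.1 (principalHom_mem (Units.map (algebraMap (𝓞 F) F).toMonoidHom e))
  rw [show (principalHom F (Units.map (algebraMap (𝓞 F) F).toMonoidHom e)).1 = 1 from
    toPrincipalIdeal_eq_one_iff.2 ⟨e, rfl⟩] at h
  rw [mem_normOne]
  refine Eq.trans h.symm ?_
  simp

theorem mkZero_logSection_logEmbedding (e : (𝓞 F)ˣ) :
    PicZero.mk F (infiniteDivisor F (logSection (Units.logEmbedding F (Additive.ofMul e)))) = 1 := by
  have h := mkZero_of_mk_eq_one ((mk_infiniteDivisor_eq_one_iff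
    ⟨_, unitTmul_unit_mem e⟩).2 ⟨e, rfl⟩)
  rw [← h]
  apply mkZero_eq_of_realLog_eq
  rw [realLog_logSection, realLog_unit]

theorem ArF.map_mul (φ : ArF F) (p q : picDom F) :
    φ (Additive.ofMul (PicZero.mk F (p * q))) =
      φ (Additive.ofMul (PicZero.mk F p)) + φ (Additive.ofMul (PicZero.mk F q)) :=
  (show ContinuousAddMonoidHom (Additive (PicZero F)) RmodZ from φ).map_add'
    (Additive.ofMul (PicZero.mk F p)) (Additive.ofMul (PicZero.mk F q))

theorem ArF.map_one (φ : ArF F) : φ (Additive.ofMul (1 : PicZero F)) = 0 :=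
  (show ContinuousAddMonoidHom (Additive (PicZero F)) RmodZ from φ).map_zero'

theorem ArF.add_apply (φ ψ : ArF F) (z : Additive (PicZero F)) : (φ + ψ) z = φ z + ψ z := rfl

theorem ArF.zero_apply (z : Additive (PicZero F)) : (0 : ArF F) z = 0 := rfl

theorem ArF.neg_apply (φ : ArF F) (z : Additive (PicZero F)) : (-φ) z = - φ z := rfl

theorem ArF.map_pow (φ : ArF F) (p : picDom F) (n : ℕ) :
    φ (Additive.ofMul (PicZero.mk F (p ^ n))) = n • φ (Additive.ofMul (PicZero.mk F p)) := by
  induction n with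
  | zero => rw [pow_zero, zero_nsmul]; exact φ.map_one
  | succ n ih => rw [pow_succ, φ.map_mul, ih, succ_nsmul]

theorem ArF.ext {φ ψ : ArF F}
    (h : ∀ p, φ (Additive.ofMul (PicZero.mk F p)) = ψ (Additive.ofMul (PicZero.mk F p))) :
    φ = ψ := by
  refine DFunLike.coe_injective (F := ContinuousAddMonoidHom (Additive (PicZero F)) RmodZ)
    (funext fun z => ?_)
  obtain ⟨q, hq⟩ := QuotientGroup.mk_surjective (s := compImage F) z.toMul
  obtain ⟨p, rfl⟩ := QuotientGroup.mk_surjective (s := principalSub F) q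
  have := h p
  rw [show Additive.ofMul (PicZero.mk F p) = z from hq] at this
  exact this

/-- The ideal class of an oriented Arakelov divisor. -/
noncomputable def idealClass (F : Type) [Field F] [NumberField F] :
    picDom F →* IdealGroup F ⧸ (toPrincipalIdeal (𝓞 F) F).range :=
  (QuotientGroup.mk' _).comp ((MonoidHom.fst _ _).comp (picDom F).subtype)

theorem ArF.eq_of_idealClass_eq {φ : ArF F}
    (hφ : ∀ b, φ (Additive.ofMul (PicZero.mk F (infiniteDivisor F b))) = 0) {p q : picDom F}
    (h : idealClass F p = idealClass F q) :
    φ (Additive.ofMul (PicZero.mk F p)) = φ (Additive.ofMul (PicZero.mk F q)) := by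
  obtain ⟨a, ha⟩ := QuotientGroup.eq.1 h
  let r : picDom F := ⟨principalHom F a, principalHom_mem a⟩
  have hr : PicTilde.mk F r = 1 := by
    rw [← mk_one, eq_comm, mk_eq_mk_iff]
    exact ⟨a, by simp [r]⟩
  let s : picDom F := (p * r)⁻¹ * q
  have hs1 : (s : IdealGroup F × (FReal F)ˣ).1 = 1 := by
    change ((p : IdealGroup F × (FReal F)ˣ).1 * toPrincipalIdeal (𝓞 F) F a)⁻¹ *
      (q : IdealGroup F × (FReal F)ˣ).1 = 1
    rw [ha]
    change ((p : IdealGroup F × (FReal F)ˣ).1 * ((p : IdealGroup F × (FReal F)ˣ).1⁻¹ *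
      (q : IdealGroup F × (FReal F)ˣ).1))⁻¹ * (q : IdealGroup F × (FReal F)ˣ).1 = 1
    group
  have hb : (s : IdealGroup F × (FReal F)ˣ).2 ∈ normOne F := by
    have := mem_picDom.1 s.2
    rw [hs1] at this
    rw [mem_normOne, ← this]
    simp
  have hs : s = infiniteDivisor F ⟨_, hb⟩ := Subtype.ext (Prod.ext hs1 rfl)
  have hq : q = p * r * s := (mul_inv_cancel_left (p * r) q).symm
  rw [hq, φ.map_mul, φ.map_mul, hs, hφ, mkZero_of_mk_eq_one hr, φ.map_one, add_zero, add_zero]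

instance : Finite (IdealGroup F ⧸ (toPrincipalIdeal (𝓞 F) F).range) :=
  Finite.of_equiv _ (ClassGroup.equiv (R := 𝓞 F) F).toEquiv

theorem finite_arF_trivial_on_infinite :
    {φ : ArF F | ∀ b, φ (Additive.ofMul (PicZero.mk F (infiniteDivisor F b))) = 0}.Finite := by
  classical
  let C := IdealGroup F ⧸ (toPrincipalIdeal (𝓞 F) F).range
  let n := Nat.card C
  have hn : 0 < n := Nat.card_pos
  let rep : C → picDom F := fun c => if h : ∃ p, idealClass F p = c then h.choose else 1
  have hrep : ∀ p, idealClass F (rep (idealClass F p)) = idealClass F p := fun p => by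
    have h : ∃ q, idealClass F q = idealClass F p := ⟨p, rfl⟩
    simp only [rep, dif_pos h]
    exact h.choose_spec
  have : Finite {u : RmodZ | n • u = 0} := AddCircle.finite_torsion 1 hn
  refine Set.finite_coe_iff.1 (Finite.of_injective (β := C → {u : RmodZ | n • u = 0})
    (fun φ c => ⟨φ.1 (Additive.ofMul (PicZero.mk F (rep c))), ?_⟩) ?_)
  · rw [Set.mem_ofPred_eq, ← ArF.map_pow, ArF.eq_of_idealClass_eq φ.2 (q := 1)]
    · exact φ.1.map_one
    · rw [map_pow, map_one, pow_card_eq_one']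
  · intro φ ψ h
    refine Subtype.ext (ArF.ext fun p => ?_)
    rw [← ArF.eq_of_idealClass_eq φ.2 (hrep p), ← ArF.eq_of_idealClass_eq ψ.2 (hrep p)]
    exact congrArg Subtype.val (congrFun h (idealClass F p))

end FiniteGeneration

section ArakelovDualFinite

variable {F : Type} [Field F] [NumberField F]

theorem finite_int_of_linearMap {M N : Type} [AddCommGroup M] [AddCommGroup N]
    [Module.Finite ℤ N] (f : M →ₗ[ℤ] N) (hf : Finite (LinearMap.ker f)) : Module.Finite ℤ M := by
  refine ⟨Submodule.fg_of_fg_map_of_fg_inf_ker f (IsNoetherian.noetherian _) ?_⟩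
  rw [top_inf_eq, ← Module.Finite.iff_fg]
  infer_instance

instance finite_arF : Module.Finite ℤ (ArF F) := by
  classical
  let B := (Units.basisUnitLattice F).ofZLatticeBasis ℝ (Units.unitLattice F)
  let ev : Units.dirichletUnitTheorem.logSpace F → Additive (PicZero F) := fun v =>
    Additive.ofMul (PicZero.mk F (infiniteDivisor F (logSection v)))
  have hev : ∀ v v', ev (v + v') = ev v + ev v' := fun v v' => by
    change Additive.ofMul (PicZero.mk F _) = _
    rw [logSection_add, map_mul, mkZero_mul]
    rfl
  have hevc : Continuous ev :=
    continuous_mkZero.comp (continuous_infiniteDivisor.comp continuous_logSection)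
  let S : Submodule ℤ (ArF F × (Fin (Units.rank F) → ℤ)) := AddSubgroup.toIntSubmodule
    { carrier := {p | ∀ v, p.1 (ev v) = ((∑ i, p.2 i * B.repr v i : ℝ) : RmodZ)}
      zero_mem' := fun v => by simp [ArF.zero_apply]
      add_mem' := fun {p q} hp hq v => by
        rw [Prod.fst_add, ArF.add_apply, hp v, hq v, ← AddCircle.coe_add, ← Finset.sum_add_distrib]
        simp [add_mul]
      neg_mem' := fun {p} hp v => by
        rw [Prod.fst_neg, ArF.neg_apply, hp v, ← AddCircle.coe_neg, ← Finset.sum_neg_distrib]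
        simp }
  have hS : Module.Finite ℤ S := by
    let f : S →ₗ[ℤ] (Fin (Units.rank F) → ℤ) := (LinearMap.snd ℤ _ _).comp S.subtype
    refine finite_int_of_linearMap f ?_
    have := (finite_arF_trivial_on_infinite (F := F)).to_subtype
    refine Finite.of_injective (β := {φ : ArF F | ∀ b, φ (Additive.ofMul
      (PicZero.mk F (infiniteDivisor F b))) = 0}) (fun p => ⟨p.1.1.1, fun b => ?_⟩) ?_
    · have h0 : p.1.1.2 = 0 := p.2
      have h := p.1.2 (realLog (b : (FReal F)ˣ))
      rw [h0] at h
      rw [mkZero_eq_of_realLog_eq (c := logSection (realLog (b : (FReal F)ˣ)))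
        (realLog_logSection _).symm]
      refine h.trans ?_
      simp
    · intro p q h
      refine Subtype.ext (Subtype.ext (Prod.ext (congrArg Subtype.val h) ?_))
      exact Eq.trans p.2 (Eq.symm q.2)
  refine Module.Finite.of_surjective ((LinearMap.fst ℤ _ _).comp S.subtype) fun φ => ?_
  let f : Units.dirichletUnitTheorem.logSpace F →+ RmodZ :=
    AddMonoidHom.mk' (fun v => φ (ev v)) fun v v' => by
      rw [hev]
      exact (show ContinuousAddMonoidHom (Additive (PicZero F)) RmodZ from φ).map_add' _ _
  have hf : Continuous f :=
    (show ContinuousAddMonoidHom (Additive (PicZero F)) RmodZ from φ).continuous_toFun.comp hevc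
  obtain ⟨a, ha⟩ := exists_linear_lift f hf
  have hint : ∀ i, ∃ n : ℤ, (n : ℝ) = a (B i) := fun i => by
    have h1 : f (B i) = 0 := by
      have : B i = Units.logEmbedding F (Additive.ofMul (Units.fundSystem F i)) := by
        rw [Units.logEmbedding_fundSystem, Module.Basis.ofZLatticeBasis_apply]
      change φ (ev (B i)) = 0
      rw [this]
      change φ (Additive.ofMul (PicZero.mk F _)) = 0
      rw [mkZero_logSection_logEmbedding]
      exact φ.map_one
    rw [ha, AddCircle.coe_eq_zero_iff] at h1
    obtain ⟨n, hn⟩ := h1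
    exact ⟨n, by simpa using hn⟩
  choose n hn using hint
  refine ⟨⟨(φ, n), fun v => (ha v).trans ?_⟩, rfl⟩
  congr 1
  conv_lhs => rw [← B.sum_repr v, map_sum]
  refine Finset.sum_congr rfl fun i _ => ?_
  rw [map_smul, smul_eq_mul, hn, mul_comm]

end ArakelovDualFinite

section EmbeddingModule

variable {K F G : Type} [Field K] [NumberField K] [Field F] [NumberField F] [Algebra K F] [Group G]

/-- The module of integer-valued functions on the set of complex embeddings of `F`. -/
def EmbFun (_ : G ≃* (F ≃ₐ[K] F)) : Type := (F →+* ℂ) → ℤ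

variable (iso : G ≃* (F ≃ₐ[K] F))

noncomputable instance : AddCommGroup (EmbFun iso) := inferInstanceAs (AddCommGroup ((F →+* ℂ) → ℤ))

instance : Module.Finite ℤ (EmbFun iso) := inferInstanceAs (Module.Finite ℤ ((F →+* ℂ) → ℤ))

/-- The representation of `G` on functions on complex embeddings by right translation. -/
noncomputable def embFunRep : G →* Module.End ℤ (EmbFun iso) where
  toFun g := AddMonoidHom.toIntLinearMap
    (AddMonoidHom.mk' (fun x τ => x (τ.comp (iso g : F →+* F))) fun _ _ => rfl)
  map_one' := by
    ext x
    refine funext fun τ => congrArg x ?_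
    ext a
    simp
  map_mul' g h := by
    ext x
    refine funext fun τ => congrArg x ?_
    ext a
    simp

noncomputable instance : Module (MonoidAlgebra ℤ G) (EmbFun iso) := groupRingModule (embFunRep iso)

variable {iso}

theorem EmbFun.single_smul (g : G) (x : EmbFun iso) (τ : F →+* ℂ) :
    ((MonoidAlgebra.single g (1 : ℤ) : MonoidAlgebra ℤ G) • x) τ =
      x (τ.comp (iso g : F →+* F)) := by
  rw [groupRingModule_single_smul]
  rfl

instance [Finite G] : Module.Finite (MonoidAlgebra ℤ G) (EmbFun iso) := finite_groupRing

variable (iso) in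
theorem bijective_embeddingEquiv [IsGalois K F] :
    Function.Bijective fun p : (K →+* ℂ) × G =>
      (ComplexEmbedding.lift F p.1).comp (iso p.2⁻¹ : F →+* F) := by
  have hres : ∀ p : (K →+* ℂ) × G, ((ComplexEmbedding.lift F p.1).comp
      (iso p.2⁻¹ : F →+* F)).comp (algebraMap K F) = p.1 := fun p => by
    conv_rhs => rw [← ComplexEmbedding.lift_comp_algebraMap (K := F) p.1]
    ext a
    simp
  constructor
  · rintro ⟨k, g⟩ ⟨k', g'⟩ h
    have hk : k = k' := (hres (k, g)).symm.trans
      ((congrArg (fun τ : F →+* ℂ => τ.comp (algebraMap K F)) h).trans (hres (k', g')))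
    subst hk
    have hg : iso g⁻¹ = iso g'⁻¹ := AlgEquiv.ext fun a =>
      (ComplexEmbedding.lift F k).injective (RingHom.congr_fun h a)
    rw [inv_injective (iso.injective hg)]
  · intro τ
    obtain ⟨s, hs⟩ := ComplexEmbedding.exists_comp_symm_eq_of_comp_eq (k := K)
      (ComplexEmbedding.lift F (τ.comp (algebraMap K F))) τ (by simp)
    refine ⟨(τ.comp (algebraMap K F), iso.symm s), ?_⟩
    refine Eq.trans ?_ hs
    ext a
    simp

variable (iso) in
/-- The comparison map from functions on complex embeddings to a free module. -/
noncomputable def embFunToFree [Finite G] : EmbFun iso →ₗ[MonoidAlgebra ℤ G]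
    ((K →+* ℂ) → MonoidAlgebra ℤ G) :=
  AddMonoidHom.toGroupRingLinearMap
    (AddMonoidHom.mk' (fun x k => MonoidAlgebra.ofCoeff (Finsupp.equivFunOnFinite.symm fun g =>
      x ((ComplexEmbedding.lift F k).comp (iso g⁻¹ : F →+* F)))) fun x y => by
        funext k
        ext g
        rfl) fun h x => by
      funext k
      ext g
      rw [Pi.smul_apply, smul_eq_mul, MonoidAlgebra.coeff_single_mul_apply, one_mul]
      refine (EmbFun.single_smul h x _).trans (congrArg x ?_)
      ext a
      simp

theorem cls_embFun [IsGalois K F] [Finite G] :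
    G0.cls (MonoidAlgebra ℤ G) (EmbFun iso) =
      Module.finrank ℚ K • G0.cls (MonoidAlgebra ℤ G) (MonoidAlgebra ℤ G) := by
  let e := Equiv.ofBijective _ (bijective_embeddingEquiv iso)
  have hbij : Function.Bijective (embFunToFree iso) := by
    constructor
    · intro x y h
      refine funext fun τ => ?_
      obtain ⟨⟨k, g⟩, rfl⟩ := (bijective_embeddingEquiv iso).2 τ
      exact DFunLike.congr_fun (congrArg MonoidAlgebra.coeff (congrFun h k)) g
    · intro y
      refine ⟨fun τ => (y (e.symm τ).1).coeff (e.symm τ).2, ?_⟩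
      funext k
      ext g
      change (y (e.symm (e (k, g))).1).coeff (e.symm (e (k, g))).2 = _
      rw [Equiv.symm_apply_apply]
  rw [G0.cls_congr (LinearEquiv.ofBijective _ hbij), G0.cls_pi, Nat.card_eq_fintype_card,
    Embeddings.card]

end EmbeddingModule

section RootsOfUnity

/-- The inclusion of `ℚ/ℤ` into `ℝ/ℤ`. -/
noncomputable def ratToCircle : QmodZ →ₗ[ℤ] RmodZ :=
  (Submodule.span ℤ {(1 : ℚ)}).liftQ
    (AddMonoidHom.toIntLinearMap ((QuotientAddGroup.mk' (AddSubgroup.zmultiples (1 : ℝ))).comp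
      (Rat.castHom ℝ).toAddMonoidHom)) <| by
    rw [Submodule.span_singleton_le_iff_mem, LinearMap.mem_ker]
    change (((1 : ℚ) : ℝ) : RmodZ) = 0
    rw [Rat.cast_one, AddCircle.coe_eq_zero_iff]
    exact ⟨1, one_smul _ _⟩

theorem ratToCircle_mk (q : ℚ) :
    ratToCircle (Submodule.Quotient.mk q) = ((q : ℝ) : RmodZ) := rfl

theorem ratToCircle_injective : Function.Injective ratToCircle := by
  rw [← LinearMap.ker_eq_bot, LinearMap.ker_eq_bot']
  intro u hu
  obtain ⟨q, rfl⟩ := Submodule.Quotient.mk_surjective _ u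
  rw [ratToCircle_mk, AddCircle.coe_eq_zero_iff] at hu
  obtain ⟨n, hn⟩ := hu
  rw [Submodule.Quotient.mk_eq_zero, Submodule.mem_span_singleton]
  refine ⟨n, ?_⟩
  rw [zsmul_eq_mul, mul_one] at hn ⊢
  exact_mod_cast hn

theorem exists_ratToCircle_eq {u : RmodZ} {n : ℕ} (hn : 0 < n) (hu : n • u = 0) :
    ∃ q, ratToCircle q = u := by
  obtain ⟨t, rfl⟩ := QuotientAddGroup.mk_surjective u
  have h : ((n • t : ℝ) : RmodZ) = 0 := hu
  rw [AddCircle.coe_eq_zero_iff] at h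
  obtain ⟨m, hm⟩ := h
  refine ⟨Submodule.Quotient.mk (m / n : ℚ), ?_⟩
  rw [ratToCircle_mk]
  have hn' : (n : ℝ) ≠ 0 := by positivity
  have : ((m / n : ℚ) : ℝ) = t := by
    push_cast
    rw [div_eq_iff hn', mul_comm]
    simpa using hm
  rw [this]

theorem exists_ratToCircle_lift {N : Type} [AddCommGroup N] [Finite N] (f : N →+ RmodZ) :
    ∃ f' : N →ₗ[ℤ] QmodZ, ∀ a, ratToCircle (f' a) = f a := by
  have h : ∀ a, ∃ q, ratToCircle q = f a := fun a =>
    exists_ratToCircle_eq (n := Nat.card N) Nat.card_pos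
      (by rw [← map_nsmul, card_nsmul_eq_zero', map_zero])
  choose q hq using h
  exact ⟨AddMonoidHom.toIntLinearMap (AddMonoidHom.mk' q fun a b => ratToCircle_injective (by
    rw [map_add, hq, hq, hq, map_add])), hq⟩

variable {F : Type} [Field F] [NumberField F]

theorem exists_ringOfIntegers_unit_eq (z : CommGroup.torsion Fˣ) :
    ∃ e : (𝓞 F)ˣ, Units.map (algebraMap (𝓞 F) F).toMonoidHom e = z := by
  have hint : ∀ z : CommGroup.torsion Fˣ, IsIntegral ℤ ((z : Fˣ) : F) := fun z => by
    obtain ⟨n, hn, h⟩ := isOfFinOrder_iff_pow_eq_one.1 z.2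
    refine IsIntegral.of_pow hn ?_
    rw [← Units.val_pow_eq_pow_val, h]
    exact isIntegral_one
  exact ⟨⟨⟨_, hint z⟩, ⟨_, hint z⁻¹⟩, RingOfIntegers.ext (Units.mul_inv (z : Fˣ)),
    RingOfIntegers.ext (Units.inv_mul (z : Fˣ))⟩, Units.ext rfl⟩

instance : Finite (CommGroup.torsion Fˣ) := by
  refine Finite.of_surjective (α := Units.torsion F)
    (fun e => ⟨Units.map (algebraMap (𝓞 F) F).toMonoidHom e, MonoidHom.isOfFinOrder _ e.2⟩) ?_
  intro z
  obtain ⟨e, he⟩ := exists_ringOfIntegers_unit_eq z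
  refine ⟨⟨e, ?_⟩, Subtype.ext he⟩
  have hinj : Function.Injective (Units.map (algebraMap (𝓞 F) F).toMonoidHom) :=
    Units.map_injective (FaithfulSMul.algebraMap_injective (𝓞 F) F)
  refine (isOfFinOrder_iff_pow_eq_one).2 ?_
  obtain ⟨n, hn, h⟩ := isOfFinOrder_iff_pow_eq_one.1 z.2
  exact ⟨n, hn, hinj (by rw [map_pow, he, h, map_one])⟩

/-- The character of the group of roots of unity attached to `x`. -/
noncomputable def torsionChar (x : (F →+* ℂ) → ℤ) : Additive (CommGroup.torsion Fˣ) →+ RmodZ :=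
  AddMonoidHom.mk' (fun z => embChar x (unitTmul F (z.toMul : Fˣ))) fun a b => by
    rw [toMul_add, Subgroup.coe_mul, map_mul, embChar_mul]

theorem ev_unitTmul (τ : F →+* ℂ) (a : Fˣ) : FReal.ev τ (unitTmul F a : FReal F) = τ a := by
  rw [coe_unitTmul, FReal.ev_tmul, Complex.ofReal_one, one_mul]

theorem exists_torsionChar_eq (f : Additive (CommGroup.torsion Fˣ) →+ RmodZ) :
    ∃ x, torsionChar x = f := by
  classical
  obtain ⟨τ⟩ : Nonempty (F →+* ℂ) := inferInstance
  obtain ⟨z, hz⟩ := IsCyclic.exists_generator (α := CommGroup.torsion Fˣ)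
  let n := orderOf z
  have hn : 0 < n := orderOf_pos z
  have hprim : IsPrimitiveRoot (τ ((z : Fˣ) : F)) n := by
    have h1 : IsPrimitiveRoot z n := IsPrimitiveRoot.orderOf z
    have h2 : IsPrimitiveRoot (z : Fˣ) n :=
      h1.map_of_injective (f := (CommGroup.torsion Fˣ).subtype) Subtype.val_injective
    exact (IsPrimitiveRoot.coe_units_iff.2 h2).map_of_injective τ.injective
  obtain ⟨t, ht⟩ := QuotientAddGroup.mk_surjective (f (Additive.ofMul z))
  have hnt : ((n • t : ℝ) : RmodZ) = 0 := by
    change n • ((t : ℝ) : RmodZ) = 0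
    refine (congrArg (n • ·) ht).trans ?_
    change n • f (Additive.ofMul z) = 0
    rw [← map_nsmul, ← ofMul_pow, pow_orderOf_eq_one, ofMul_one, map_zero]
  obtain ⟨m, hm⟩ := AddCircle.coe_eq_zero_iff _ |>.1 hnt
  have hroot : Complex.exp (2 * Real.pi * t * Complex.I) ^ n = 1 := by
    rw [← Complex.exp_nat_mul, Complex.exp_eq_one_iff]
    refine ⟨m, ?_⟩
    have : (m : ℂ) = n * t := by
      have h : (m : ℝ) = n * t := by simpa using hm
      exact_mod_cast h
    rw [this]
    ring
  have : NeZero n := ⟨hn.ne'⟩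
  obtain ⟨i, -, hi⟩ := hprim.eq_pow_of_pow_eq_one hroot
  refine ⟨Pi.single τ (i : ℤ), ?_⟩
  have hzz : torsionChar (Pi.single τ (i : ℤ)) (Additive.ofMul z) = f (Additive.ofMul z) := by
    change embChar _ (unitTmul F (z : Fˣ)) = _
    rw [embChar, Finset.sum_eq_single τ]
    · rw [Pi.single_eq_same, ev_unitTmul, ← ht]
      refine Eq.trans ?_ (cangle_exp t)
      rw [← hi]
      have hne : τ ((z : Fˣ) : F) ≠ 0 := hprim.ne_zero hn.ne'
      clear hi hroot
      induction i with
      | zero => simp [cangle_one]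
      | succ i ih =>
        rw [pow_succ, cangle_mul (pow_ne_zero _ hne) hne, ← ih]
        push_cast
        rw [add_smul, one_smul]
    · intro τ' _ h
      rw [Pi.single_eq_of_ne h, zero_smul]
    · simp
  refine AddMonoidHom.ext fun a => ?_
  obtain ⟨k, hk⟩ := hz a.toMul
  have ha : a = k • Additive.ofMul z := by
    rw [← ofMul_zpow]
    exact congrArg Additive.ofMul hk.symm
  rw [ha, map_zsmul, map_zsmul, hzz]

end RootsOfUnity

section GaloisAction

variable {K F G : Type} [Field K] [NumberField K] [Field F] [NumberField F] [Algebra K F] [Group G]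

/-- The Galois action on `F_ℝˣ`. -/
noncomputable def galUnits (s : F ≃ₐ[K] F) : (FReal F)ˣ →* (FReal F)ˣ :=
  Units.map ((galFReal K s : FReal F ≃ₐ[ℚ] FReal F) : FReal F →* FReal F)

theorem coe_galUnits (s : F ≃ₐ[K] F) (b : (FReal F)ˣ) :
    (galUnits s b : FReal F) = galFReal K s b := rfl

theorem galUnits_unitTmul (s : F ≃ₐ[K] F) (a : Fˣ) :
    galUnits s (unitTmul F a) = unitTmul F (Units.map (s : F →* F) a) := by
  ext
  rw [coe_galUnits, coe_unitTmul, coe_unitTmul]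
  exact Algebra.TensorProduct.map_tmul _ _ _ _

theorem galUnits_mem_normOneEverywhere (s : F ≃ₐ[K] F) {u : (FReal F)ˣ}
    (hu : u ∈ normOneEverywhere F) : galUnits s u ∈ normOneEverywhere F := by
  intro w
  rw [← FReal.norm_ev_embedding, coe_galUnits, FReal.ev_galFReal, FReal.norm_ev, hu]

theorem embChar_zero (b : (FReal F)ˣ) : embChar (0 : (F →+* ℂ) → ℤ) b = 0 :=
  Finset.sum_eq_zero fun _ _ => zero_smul ℤ _

theorem embChar_neg (x : (F →+* ℂ) → ℤ) (b : (FReal F)ˣ) : embChar (-x) b = -embChar x b := by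
  rw [eq_neg_iff_add_eq_zero, ← embChar_add, neg_add_cancel, embChar_zero]

variable {iso : G ≃* (F ≃ₐ[K] F)}

theorem embChar_single_smul (g : G) (x : EmbFun iso) (b : (FReal F)ˣ) :
    embChar ((MonoidAlgebra.single g (1 : ℤ) : MonoidAlgebra ℤ G) • x : EmbFun iso) b =
      embChar x (galUnits (iso g⁻¹) b) := by
  let e : (F →+* ℂ) ≃ (F →+* ℂ) :=
    { toFun := fun τ => τ.comp (iso g : F →+* F)
      invFun := fun τ => τ.comp (iso g⁻¹ : F →+* F)
      left_inv := fun τ => by ext; simp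
      right_inv := fun τ => by ext; simp }
  unfold embChar
  rw [← e.symm.sum_comp]
  refine Finset.sum_congr rfl fun τ _ => ?_
  rw [EmbFun.single_smul, coe_galUnits, FReal.ev_galFReal]
  congr 4
  exact e.apply_symm_apply τ

theorem isOfFinOrder_map (s : F ≃ₐ[K] F) (z : CommGroup.torsion Fˣ) :
    Units.map (s : F →* F) z ∈ CommGroup.torsion Fˣ :=
  MonoidHom.isOfFinOrder _ z.2

variable (iso) in
/-- The functions whose character is trivial on roots of unity. -/
noncomputable def torsionTrivial : Submodule (MonoidAlgebra ℤ G) (EmbFun iso) :=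
  AddSubgroup.toGroupRingSubmodule
    { carrier := {x | ∀ z : CommGroup.torsion Fˣ, embChar x (unitTmul F z) = 0}
      zero_mem' := fun z => embChar_zero _
      add_mem' := fun {x y} hx hy z => by
        refine (embChar_add x y _).trans ?_
        rw [hx, hy, add_zero]
      neg_mem' := fun {x} hx z => by
        rw [← neg_zero, ← hx z]
        exact embChar_neg x _ } fun g x hx z => by
    refine (embChar_single_smul g x _).trans ?_
    rw [galUnits_unitTmul]
    exact hx ⟨_, isOfFinOrder_map (iso g⁻¹) z⟩

theorem mem_torsionTrivial {x : EmbFun iso} : x ∈ torsionTrivial iso ↔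
    ∀ z : CommGroup.torsion Fˣ, embChar x (unitTmul F z) = 0 := Iff.rfl

/-- The representation on the `ℚ/ℤ`-dual of a module over the group ring. -/
noncomputable def dualRep (N : Type) [AddCommGroup N] [Module (MonoidAlgebra ℤ G) N] :
    G →* Module.End ℤ (N →ₗ[ℤ] QmodZ) where
  toFun g := AddMonoidHom.toIntLinearMap (AddMonoidHom.mk' (fun φ => φ.comp
    (AddMonoidHom.toIntLinearMap (DistribSMul.toAddMonoidHom N
      (MonoidAlgebra.single g⁻¹ (1 : ℤ) : MonoidAlgebra ℤ G)))) fun _ _ => rfl)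
  map_one' := by
    refine LinearMap.ext fun φ => LinearMap.ext fun a => congrArg φ ?_
    change (MonoidAlgebra.single (1 : G)⁻¹ (1 : ℤ) : MonoidAlgebra ℤ G) • a = a
    rw [inv_one, ← MonoidAlgebra.one_def, one_smul]
  map_mul' g h := by
    refine LinearMap.ext fun φ => LinearMap.ext fun a => congrArg φ ?_
    change (MonoidAlgebra.single (g * h)⁻¹ (1 : ℤ) : MonoidAlgebra ℤ G) • a =
      (MonoidAlgebra.single h⁻¹ (1 : ℤ) : MonoidAlgebra ℤ G) •
        (MonoidAlgebra.single g⁻¹ (1 : ℤ) : MonoidAlgebra ℤ G) • a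
    rw [smul_smul, MonoidAlgebra.single_mul_single, one_mul, mul_inv_rev]

theorem cls_embFun_eq_torsionTrivial_add [Finite G]
    [Module (MonoidAlgebra ℤ G) (Additive (CommGroup.torsion Fˣ))]
    (hmMu : ∀ (g : G) (u v : CommGroup.torsion Fˣ), ((v : Fˣ) : F) = iso g ((u : Fˣ) : F) →
      (MonoidAlgebra.single g (1 : ℤ) : MonoidAlgebra ℤ G) • Additive.ofMul u =
        Additive.ofMul v)
    [Module (MonoidAlgebra ℤ G) (Additive (CommGroup.torsion Fˣ) →ₗ[ℤ] QmodZ)]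
    (hdual : ∀ (g : G) (φ : Additive (CommGroup.torsion Fˣ) →ₗ[ℤ] QmodZ) x,
        ((MonoidAlgebra.single g (1 : ℤ) : MonoidAlgebra ℤ G) • φ) x =
          φ ((MonoidAlgebra.single g⁻¹ (1 : ℤ) : MonoidAlgebra ℤ G) • x)) :
    G0.cls (MonoidAlgebra ℤ G) (EmbFun iso) = G0.cls (MonoidAlgebra ℤ G) (torsionTrivial iso) +
      G0.cls (MonoidAlgebra ℤ G) (Additive (CommGroup.torsion Fˣ) →ₗ[ℤ] QmodZ) := by
  have : Finite (Additive (CommGroup.torsion Fˣ)) :=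
    inferInstanceAs (Finite (CommGroup.torsion Fˣ))
  choose r hr using fun x : EmbFun iso => exists_ratToCircle_lift (torsionChar x)
  have hr' : ∀ x (z : CommGroup.torsion Fˣ), ratToCircle (r x (Additive.ofMul z)) =
      embChar x (unitTmul F z) := fun x z => hr x (Additive.ofMul z)
  let R : EmbFun iso →ₗ[MonoidAlgebra ℤ G] (Additive (CommGroup.torsion Fˣ) →ₗ[ℤ] QmodZ) :=
    AddMonoidHom.toGroupRingLinearMap (AddMonoidHom.mk' r fun x y => by
        refine LinearMap.ext fun z => ratToCircle_injective ?_
        rw [LinearMap.add_apply, map_add, hr, hr, hr]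
        exact embChar_add _ _ _) fun g x => by
      refine LinearMap.ext fun z => ratToCircle_injective ?_
      rw [hdual]
      change ratToCircle (r _ _) = ratToCircle (r _ _)
      have hz := hmMu g⁻¹ z.toMul ⟨_, isOfFinOrder_map (iso g⁻¹) z.toMul⟩ rfl
      rw [ofMul_toMul] at hz
      rw [hr, hz, hr']
      refine (embChar_single_smul g x _).trans ?_
      rw [galUnits_unitTmul]
  have hR : Function.Surjective R := fun φ => by
    obtain ⟨x, hx⟩ := exists_torsionChar_eq (ratToCircle.toAddMonoidHom.comp φ.toAddMonoidHom)
    refine ⟨x, LinearMap.ext fun z => ratToCircle_injective ?_⟩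
    exact (hr x z).trans (DFunLike.congr_fun hx z)
  have hker : LinearMap.ker R = torsionTrivial iso := by
    ext x
    rw [LinearMap.mem_ker, mem_torsionTrivial]
    constructor
    · intro h z
      rw [← hr', show r x = 0 from h, LinearMap.zero_apply, map_zero]
    · intro h
      refine LinearMap.ext fun z => ratToCircle_injective ?_
      rw [LinearMap.zero_apply, map_zero]
      exact (hr x z).trans (h z.toMul)
  rw [G0.cls_eq_ker_add R hR, hker]

end GaloisAction

section CompactRestriction

variable {F : Type} [Field F] [NumberField F]

theorem ArTilde.map_mk_mul (φ : ArTilde F) (p q : picDom F) :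
    φ (Additive.ofMul (PicTilde.mk F (p * q))) =
      φ (Additive.ofMul (PicTilde.mk F p)) + φ (Additive.ofMul (PicTilde.mk F q)) :=
  (show ContinuousAddMonoidHom (Additive (PicTilde F)) RmodZ from φ).map_add'
    (Additive.ofMul (PicTilde.mk F p)) (Additive.ofMul (PicTilde.mk F q))

theorem ArTilde.map_ofMul_one (φ : ArTilde F) : φ (Additive.ofMul (1 : PicTilde F)) = 0 :=
  (show ContinuousAddMonoidHom (Additive (PicTilde F)) RmodZ from φ).map_zero'

theorem ArTilde.continuous (φ : ArTilde F) : Continuous φ :=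
  (show ContinuousAddMonoidHom (Additive (PicTilde F)) RmodZ from φ).continuous_toFun

theorem ArTilde.add_apply (φ ψ : ArTilde F) (z : Additive (PicTilde F)) :
    (φ + ψ) z = φ z + ψ z := rfl

theorem ArTilde.zero_apply (z : Additive (PicTilde F)) : (0 : ArTilde F) z = 0 := rfl

theorem ArTilde.neg_apply (φ : ArTilde F) (z : Additive (PicTilde F)) : (-φ) z = - φ z := rfl

theorem ArTilde.ext {φ ψ : ArTilde F}
    (h : ∀ p, φ (Additive.ofMul (PicTilde.mk F p)) = ψ (Additive.ofMul (PicTilde.mk F p))) :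
    φ = ψ := by
  refine DFunLike.coe_injective (F := ContinuousAddMonoidHom (Additive (PicTilde F)) RmodZ)
    (funext fun z => ?_)
  obtain ⟨p, hp⟩ := QuotientGroup.mk_surjective (s := principalSub F) z.toMul
  have hz : z = Additive.ofMul (PicTilde.mk F p) := hp.symm
  rw [hz]
  exact h p

/-- The character `φ` restricts to the character attached to `x` on the maximal compact
subgroup. -/
def ArTilde.Restricts (φ : ArTilde F) (x : (F →+* ℂ) → ℤ) : Prop :=
  ∀ b : normOne F, (b : (FReal F)ˣ) ∈ normOneEverywhere F →
    φ (Additive.ofMul (PicTilde.mk F (infiniteDivisor F b))) = embChar x b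

theorem ArTilde.exists_restricts (φ : ArTilde F) : ∃ x, φ.Restricts x := by
  classical
  let ψ : (FReal F)ˣ → RmodZ := fun b =>
    if h : b ∈ normOne F then φ (Additive.ofMul (PicTilde.mk F (infiniteDivisor F ⟨b, h⟩))) else 0
  have hψ : ∀ b : normOne F,
      ψ b = φ (Additive.ofMul (PicTilde.mk F (infiniteDivisor F b))) := fun b => dif_pos b.2
  obtain ⟨x, hx⟩ := exists_embChar_eq ψ (fun u hu v hv => by
      have := φ.map_mk_mul (infiniteDivisor F ⟨u, normOneEverywhere_le hu⟩)
        (infiniteDivisor F ⟨v, normOneEverywhere_le hv⟩)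
      rw [← map_mul, ← hψ, ← hψ, ← hψ] at this
      exact this) (ContinuousOn.mono (s := normOne F) (by
        rw [continuousOn_iff_continuous_domRestrict]
        have : (normOne F : Set (FReal F)ˣ).domRestrict ψ = fun b : normOne F =>
          φ (Additive.ofMul (PicTilde.mk F (infiniteDivisor F b))) := funext hψ
        rw [this]
        exact φ.continuous.comp (continuous_mk.comp continuous_infiniteDivisor))
      normOneEverywhere_le)
  exact ⟨x, fun b hb => (hψ b).symm.trans (hx b hb)⟩

theorem unitTmul_mem_normOneEverywhere (z : CommGroup.torsion Fˣ) :
    unitTmul F z ∈ normOneEverywhere F := by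
  intro w
  obtain ⟨n, hn, h⟩ := isOfFinOrder_iff_pow_eq_one.1 z.2
  refine (pow_eq_one_iff_of_nonneg (mixedEmbedding.normAtPlace_nonneg _ _) hn.ne').1 ?_
  rw [← map_pow, ← map_pow, ← Units.val_pow_eq_pow_val, ← map_pow, h]
  simp

theorem ArTilde.Restricts.embChar_unitTmul {φ : ArTilde F} {x : (F →+* ℂ) → ℤ}
    (h : φ.Restricts x) (z : CommGroup.torsion Fˣ) : embChar x (unitTmul F z) = 0 := by
  have hz := unitTmul_mem_normOneEverywhere z
  obtain ⟨e, he⟩ := exists_ringOfIntegers_unit_eq z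
  rw [← h ⟨_, normOneEverywhere_le hz⟩ hz,
    (mk_infiniteDivisor_eq_one_iff ⟨_, normOneEverywhere_le hz⟩).2 ⟨e, by rw [he]⟩,
    ArTilde.map_ofMul_one]

/-- Inflation of characters from the Arakelov class group. -/
noncomputable def ArF.inflate (φ : ArF F) : ArTilde F :=
  (show ContinuousAddMonoidHom (Additive (PicZero F)) RmodZ from φ).comp
    ⟨MonoidHom.toAdditive (QuotientGroup.mk' (compImage F)),
      continuous_quotient_mk' (s := QuotientGroup.leftRel (compImage F))⟩

theorem ArF.inflate_mk (φ : ArF F) (p : picDom F) :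
    φ.inflate (Additive.ofMul (PicTilde.mk F p)) = φ (Additive.ofMul (PicZero.mk F p)) := rfl

theorem ArF.inflate_restricts (φ : ArF F) : φ.inflate.Restricts 0 := by
  intro b hb
  rw [φ.inflate_mk, mkZero_infiniteDivisor_eq_one hb, φ.map_one]
  exact (embChar_zero _).symm

theorem ArTilde.Restricts.exists_inflate_eq {φ : ArTilde F} (h : φ.Restricts 0) :
    ∃ ψ : ArF F, ψ.inflate = φ := by
  let f : Additive (PicTilde F) →+ RmodZ :=
    (show ContinuousAddMonoidHom (Additive (PicTilde F)) RmodZ from φ).toAddMonoidHom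
  have hf : compImage F ≤ (AddMonoidHom.toMultiplicativeRight f).ker := by
    rintro _ ⟨p, ⟨hp1, hp2⟩, rfl⟩
    rw [SetLike.mem_coe, maxCompact_eq] at hp2
    have hp : p = infiniteDivisor F ⟨_, normOneEverywhere_le hp2⟩ :=
      Subtype.ext (Prod.ext hp1 rfl)
    rw [hp]
    exact (h _ hp2).trans (embChar_zero _)
  let f' : PicZero F →* Multiplicative RmodZ := QuotientGroup.lift (compImage F) _ hf
  refine ⟨(⟨MonoidHom.toAdditiveLeft f', ?_⟩ :
    ContinuousAddMonoidHom (Additive (PicZero F)) RmodZ), ArTilde.ext fun p => rfl⟩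
  exact (QuotientGroup.isQuotientMap_mk (N := compImage F)).continuous_iff.2 φ.continuous

/-- The inclusion of functions on places into functions on embeddings, with multiplicity two
at real places. -/
noncomputable def placesToEmb (F : Type) [Field F] [NumberField F] :
    (InfinitePlace F →₀ ℤ) →+ ((F →+* ℂ) → ℤ) := by
  classical
  exact AddMonoidHom.mk' (fun y τ => (if ComplexEmbedding.IsReal τ then 2 else 1) *
    y (InfinitePlace.mk τ)) fun y y' => funext fun τ => mul_add _ _ _

open Classical in
theorem placesToEmb_apply (y : InfinitePlace F →₀ ℤ) (τ : F →+* ℂ) :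
    placesToEmb F y τ = (if ComplexEmbedding.IsReal τ then 2 else 1) *
      y (InfinitePlace.mk τ) := by
  rw [placesToEmb]
  rfl

theorem placesToEmb_injective : Function.Injective (placesToEmb F) := by
  intro y y' h
  ext w
  have := congrFun h w.embedding
  rw [placesToEmb_apply, placesToEmb_apply, InfinitePlace.mk_embedding] at this
  refine mul_left_cancel₀ ?_ this
  split_ifs <;> norm_num

theorem ArTilde.restricts_placesToEmb (y : InfinitePlace F →₀ ℤ) :
    (0 : ArTilde F).Restricts (placesToEmb F y) := by
  intro b hb
  rw [ArTilde.zero_apply]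
  refine ((embChar_eq_zero_iff _).2 (fun w => ⟨fun hw => ⟨y w, ?_⟩, fun hw => ?_⟩) b hb).symm
  · rw [placeCoeff, if_pos hw, placesToEmb_apply, if_pos (InfinitePlace.isReal_iff.1 hw),
      InfinitePlace.mk_embedding]
  · have hw' := mt InfinitePlace.isReal_iff.2 hw
    rw [placeCoeff, if_neg hw, placesToEmb_apply, placesToEmb_apply, if_neg hw',
      InfinitePlace.mk_conjugate_eq, if_neg (by rwa [ComplexEmbedding.isReal_conjugate_iff]),
      sub_self]

theorem ArTilde.Restricts.exists_placesToEmb_eq {x : (F →+* ℂ) → ℤ}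
    (h : (0 : ArTilde F).Restricts x) : ∃ y, placesToEmb F y = x := by
  classical
  have hx := (embChar_eq_zero_iff x).1 fun u hu =>
    (h ⟨u, normOneEverywhere_le hu⟩ hu).symm
  choose m hm using fun w => (hx w).1
  refine ⟨Finsupp.equivFunOnFinite.symm fun w => if hw : w.IsReal then m w hw else x w.embedding,
    funext fun τ => ?_⟩
  rw [placesToEmb_apply, Finsupp.equivFunOnFinite_symm_apply_apply]
  by_cases hτ : ComplexEmbedding.IsReal τ
  · have hw : (InfinitePlace.mk τ).IsReal := ⟨τ, hτ, rfl⟩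
    rw [if_pos hτ, dif_pos hw, ← hm _ hw, placeCoeff, if_pos hw,
      InfinitePlace.embedding_mk_eq_of_isReal hτ]
  · have hw : ¬ (InfinitePlace.mk τ).IsReal := by
      rwa [InfinitePlace.isReal_mk_iff]
    have h2 := (hx _).2 hw
    rw [placeCoeff, if_neg hw, sub_eq_zero] at h2
    rw [if_neg hτ, dif_neg hw, one_mul]
    rcases InfinitePlace.embedding_mk_eq τ with h | h
    · rw [h]
    · rw [h2, h]
      exact congrArg x (star_star τ)

end CompactRestriction

section Equivariance

variable {K F G : Type} [Field K] [NumberField K] [Field F] [NumberField F] [Algebra K F] [Group G]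

theorem picDom_ext {p q : picDom F}
    (h1 : ((((p : IdealGroup F × (FReal F)ˣ).1 : FractionalIdeal (𝓞 F)⁰ F) :
      Submodule (𝓞 F) F) : Set F) =
        (((q : IdealGroup F × (FReal F)ˣ).1 : FractionalIdeal (𝓞 F)⁰ F) : Submodule (𝓞 F) F))
    (h2 : ((p : IdealGroup F × (FReal F)ˣ).2 : FReal F) =
      (q : IdealGroup F × (FReal F)ˣ).2) : p = q :=
  Subtype.ext (Prod.ext
    (Units.ext (FractionalIdeal.coeToSubmodule_injective (SetLike.coe_injective h1)))
    (Units.ext h2))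

theorem image_coe_one (s : F ≃ₐ[K] F) :
    s '' ((((1 : IdealGroup F) : FractionalIdeal (𝓞 F)⁰ F) : Submodule (𝓞 F) F) : Set F) =
      (((1 : IdealGroup F) : FractionalIdeal (𝓞 F)⁰ F) : Submodule (𝓞 F) F) := by
  have hone : ∀ a : F, a ∈ ((((1 : IdealGroup F) : FractionalIdeal (𝓞 F)⁰ F) :
      Submodule (𝓞 F) F) : Set F) ↔ IsIntegral ℤ a := fun a => by
    rw [SetLike.mem_coe, FractionalIdeal.mem_coe, Units.val_one, FractionalIdeal.mem_one_iff]
    exact ⟨fun ⟨c, hc⟩ => hc ▸ c.2, fun h => ⟨⟨a, h⟩, rfl⟩⟩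
  ext a
  rw [Set.mem_image, hone]
  constructor
  · rintro ⟨c, hc, rfl⟩
    exact ((hone c).1 hc).map (s : F →+* F).toIntAlgHom
  · intro ha
    exact ⟨s.symm a, (hone _).2 (ha.map (s.symm : F →+* F).toIntAlgHom), s.apply_symm_apply a⟩

theorem eq_infiniteDivisor_galUnits (s : F ≃ₐ[K] F) (b : normOne F) {q : picDom F}
    (h1 : ((((q : IdealGroup F × (FReal F)ˣ).1 : FractionalIdeal (𝓞 F)⁰ F) :
      Submodule (𝓞 F) F) : Set F) = s '' ((((infiniteDivisor F b : IdealGroup F × (FReal F)ˣ).1 :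
        FractionalIdeal (𝓞 F)⁰ F) : Submodule (𝓞 F) F) : Set F))
    (h2 : ((q : IdealGroup F × (FReal F)ˣ).2 : FReal F) =
      galFReal K s ((infiniteDivisor F b : IdealGroup F × (FReal F)ˣ).2 : FReal F)) :
    ∃ h : galUnits s (b : (FReal F)ˣ) ∈ normOne F, q = infiniteDivisor F ⟨_, h⟩ := by
  rw [coe_infiniteDivisor, image_coe_one] at h1
  have h1' : (q : IdealGroup F × (FReal F)ˣ).1 = 1 :=
    Units.ext (FractionalIdeal.coeToSubmodule_injective (SetLike.coe_injective h1))
  have h2' : (q : IdealGroup F × (FReal F)ˣ).2 = galUnits s (b : (FReal F)ˣ) := Units.ext h2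
  have h := mem_picDom.1 q.2
  rw [h1', h2'] at h
  refine ⟨mem_normOne.2 (Eq.trans h.symm (by simp)), Subtype.ext (Prod.ext h1' h2')⟩

variable {iso : G ≃* (F ≃ₐ[K] F)}

theorem ArTilde.Restricts.single_smul [Module (MonoidAlgebra ℤ G) (ArTilde F)]
    {ρT : G → PicTilde F → PicTilde F}
    (hρT : ∀ (g : G) (x : picDom F), ∃ y : picDom F,
      ((((((y : IdealGroup F × (FReal F)ˣ).1 : FractionalIdeal (𝓞 F)⁰ F) :
          Submodule (𝓞 F) F) : Set F)) =
        (iso g) '' (((((x : IdealGroup F × (FReal F)ˣ).1 : FractionalIdeal (𝓞 F)⁰ F) :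
          Submodule (𝓞 F) F) : Set F))) ∧
      (((y : IdealGroup F × (FReal F)ˣ).2 : FReal F) =
        galFReal K (iso g) ((x : IdealGroup F × (FReal F)ˣ).2 : FReal F)) ∧
      ρT g (PicTilde.mk F x) = PicTilde.mk F y)
    (hmAT : ∀ (g : G) (φ : ArTilde F) (z : PicTilde F),
      ((MonoidAlgebra.single g (1 : ℤ) : MonoidAlgebra ℤ G) • φ) (Additive.ofMul z) =
        φ (Additive.ofMul (ρT g⁻¹ z)))
    (g : G) {φ : ArTilde F} {x : EmbFun iso} (h : φ.Restricts x) :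
    ((MonoidAlgebra.single g (1 : ℤ) : MonoidAlgebra ℤ G) • φ).Restricts
      ((MonoidAlgebra.single g (1 : ℤ) : MonoidAlgebra ℤ G) • x : EmbFun iso) := by
  intro b hb
  obtain ⟨q, h1, h2, h3⟩ := hρT g⁻¹ (infiniteDivisor F b)
  obtain ⟨hn, rfl⟩ := eq_infiniteDivisor_galUnits _ b h1 h2
  rw [hmAT, h3, h _ (galUnits_mem_normOneEverywhere _ hb)]
  exact (embChar_single_smul g x _).symm

theorem ArF.inflate_single_smul [Module (MonoidAlgebra ℤ G) (ArTilde F)]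
    {ρT : G → PicTilde F → PicTilde F}
    (hρT : ∀ (g : G) (x : picDom F), ∃ y : picDom F,
      ((((((y : IdealGroup F × (FReal F)ˣ).1 : FractionalIdeal (𝓞 F)⁰ F) :
          Submodule (𝓞 F) F) : Set F)) =
        (iso g) '' (((((x : IdealGroup F × (FReal F)ˣ).1 : FractionalIdeal (𝓞 F)⁰ F) :
          Submodule (𝓞 F) F) : Set F))) ∧
      (((y : IdealGroup F × (FReal F)ˣ).2 : FReal F) =
        galFReal K (iso g) ((x : IdealGroup F × (FReal F)ˣ).2 : FReal F)) ∧
      ρT g (PicTilde.mk F x) = PicTilde.mk F y)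
    (hmAT : ∀ (g : G) (φ : ArTilde F) (z : PicTilde F),
      ((MonoidAlgebra.single g (1 : ℤ) : MonoidAlgebra ℤ G) • φ) (Additive.ofMul z) =
        φ (Additive.ofMul (ρT g⁻¹ z)))
    [Module (MonoidAlgebra ℤ G) (ArF F)]
    {ρ0 : G → PicZero F → PicZero F}
    (hρ0 : ∀ (g : G) (x : picDom F), ∃ y : picDom F,
      ((((((y : IdealGroup F × (FReal F)ˣ).1 : FractionalIdeal (𝓞 F)⁰ F) :
          Submodule (𝓞 F) F) : Set F)) =
        (iso g) '' (((((x : IdealGroup F × (FReal F)ˣ).1 : FractionalIdeal (𝓞 F)⁰ F) :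
          Submodule (𝓞 F) F) : Set F))) ∧
      (((y : IdealGroup F × (FReal F)ˣ).2 : FReal F) =
        galFReal K (iso g) ((x : IdealGroup F × (FReal F)ˣ).2 : FReal F)) ∧
      ρ0 g (PicZero.mk F x) = PicZero.mk F y)
    (hmAr : ∀ (g : G) (φ : ArF F) (z : PicZero F),
      ((MonoidAlgebra.single g (1 : ℤ) : MonoidAlgebra ℤ G) • φ) (Additive.ofMul z) =
        φ (Additive.ofMul (ρ0 g⁻¹ z)))
    (g : G) (φ : ArF F) :
    ((MonoidAlgebra.single g (1 : ℤ) : MonoidAlgebra ℤ G) • φ).inflate =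
      (MonoidAlgebra.single g (1 : ℤ) : MonoidAlgebra ℤ G) • φ.inflate := by
  refine ArTilde.ext fun p => ?_
  obtain ⟨q, h1, h2, h3⟩ := hρT g⁻¹ p
  obtain ⟨q', h1', h2', h3'⟩ := hρ0 g⁻¹ p
  rw [ArF.inflate_mk, hmAr, hmAT, h3, h3', ArF.inflate_mk,
    picDom_ext (h1'.trans h1.symm) (h2'.trans h2.symm)]

theorem placesToEmb_single_smul [Module (MonoidAlgebra ℤ G) (InfinitePlace F →₀ ℤ)]
    (hmS : ∀ (g : G) (x : InfinitePlace F →₀ ℤ),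
      (MonoidAlgebra.single g (1 : ℤ) : MonoidAlgebra ℤ G) • x =
        Finsupp.mapDomain (fun w => iso g • w) x) (g : G) {y : InfinitePlace F →₀ ℤ}
    {x : EmbFun iso} (hx : placesToEmb F y = x) :
    placesToEmb F ((MonoidAlgebra.single g (1 : ℤ) : MonoidAlgebra ℤ G) • y) =
      ((MonoidAlgebra.single g (1 : ℤ) : MonoidAlgebra ℤ G) • x : EmbFun iso) := by
  classical
  funext τ
  refine Eq.trans ?_ (EmbFun.single_smul g x τ).symm
  rw [← hx, placesToEmb_apply, placesToEmb_apply, hmS]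
  have hw : InfinitePlace.mk τ =
      iso g • InfinitePlace.mk (τ.comp (iso g : F →+* F)) := by
    rw [InfinitePlace.smul_mk]
    congr 1
    ext a
    simp
  have hreal : ComplexEmbedding.IsReal (τ.comp (iso g : F →+* F)) ↔ ComplexEmbedding.IsReal τ := by
    rw [← InfinitePlace.isReal_mk_iff, ← InfinitePlace.isReal_mk_iff, hw,
      InfinitePlace.isReal_smul_iff]
  rw [hw, Finsupp.mapDomain_apply (MulAction.injective (iso g))]
  simp only [hreal]

/-- The pairs of a character of the oriented Arakelov class group and a function on embeddings
with the same restriction to the maximal compact subgroup. -/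
noncomputable def restrictsGraph [Module (MonoidAlgebra ℤ G) (ArTilde F)]
    (hR : ∀ (g : G) (φ : ArTilde F) (x : EmbFun iso), φ.Restricts x →
      ((MonoidAlgebra.single g (1 : ℤ) : MonoidAlgebra ℤ G) • φ).Restricts
        ((MonoidAlgebra.single g (1 : ℤ) : MonoidAlgebra ℤ G) • x : EmbFun iso)) :
    Submodule (MonoidAlgebra ℤ G) (ArTilde F × EmbFun iso) :=
  AddSubgroup.toGroupRingSubmodule
    { carrier := {p | p.1.Restricts p.2}
      zero_mem' := fun _ _ => (embChar_zero _).symm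
      add_mem' := fun {p q} hp hq b hb =>
        (congrArg₂ (· + ·) (hp b hb) (hq b hb)).trans (embChar_add p.2 q.2 _).symm
      neg_mem' := fun {p} hp b hb => (congrArg Neg.neg (hp b hb)).trans (embChar_neg p.2 _).symm }
    fun g p hp => hR g p.1 p.2 hp

section

variable [Finite G] [Module (MonoidAlgebra ℤ G) (ArTilde F)]
    (hR : ∀ (g : G) (φ : ArTilde F) (x : EmbFun iso), φ.Restricts x →
      ((MonoidAlgebra.single g (1 : ℤ) : MonoidAlgebra ℤ G) • φ).Restricts
        ((MonoidAlgebra.single g (1 : ℤ) : MonoidAlgebra ℤ G) • x : EmbFun iso))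
    [Module (MonoidAlgebra ℤ G) (ArF F)]

theorem finite_and_cls_restrictsGraph
    (hinf : ∀ (g : G) (φ : ArF F),
      ((MonoidAlgebra.single g (1 : ℤ) : MonoidAlgebra ℤ G) • φ).inflate =
        (MonoidAlgebra.single g (1 : ℤ) : MonoidAlgebra ℤ G) • φ.inflate) :
    Module.Finite (MonoidAlgebra ℤ G) (restrictsGraph hR) ∧
      G0.cls (MonoidAlgebra ℤ G) (restrictsGraph hR) =
        G0.cls (MonoidAlgebra ℤ G) (ArF F) + G0.cls (MonoidAlgebra ℤ G) (torsionTrivial iso) := by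
  let i : ArF F →ₗ[MonoidAlgebra ℤ G] restrictsGraph hR :=
    AddMonoidHom.toGroupRingLinearMap
      (AddMonoidHom.mk' (fun φ => ⟨(φ.inflate, 0), φ.inflate_restricts⟩) fun φ ψ =>
        Subtype.ext (Prod.ext rfl (add_zero (0 : EmbFun iso)).symm))
      fun g φ => Subtype.ext (Prod.ext (hinf g φ)
        (smul_zero (A := EmbFun iso) (MonoidAlgebra.single g (1 : ℤ) : MonoidAlgebra ℤ G)).symm)
  let r : restrictsGraph hR →ₗ[MonoidAlgebra ℤ G] torsionTrivial iso :=
    ((LinearMap.snd _ (ArTilde F) (EmbFun iso)).comp (restrictsGraph hR).subtype).codRestrict _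
      fun p => ArTilde.Restricts.embChar_unitTmul p.2
  have hi : Function.Injective i := fun φ ψ h => ArF.ext fun p => by
    rw [← ArF.inflate_mk, ← ArF.inflate_mk,
      show φ.inflate = ψ.inflate from congrArg (fun q => q.1.1) h]
  have hr : Function.Surjective r := fun x => by
    obtain ⟨φ, hφ⟩ := exists_arTilde_of_embChar x.1 x.2
    exact ⟨⟨(φ, x.1), hφ⟩, rfl⟩
  have hex : Function.Exact i r := fun p => by
    constructor
    · intro h
      have h0 : p.1.2 = 0 := congrArg Subtype.val h
      have hp : p.1.1.Restricts p.1.2 := p.2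
      rw [h0] at hp
      obtain ⟨ψ, hψ⟩ := hp.exists_inflate_eq
      exact ⟨ψ, Subtype.ext (Prod.ext hψ h0.symm)⟩
    · rintro ⟨φ, rfl⟩
      rfl
  have : Module.Finite (MonoidAlgebra ℤ G) (ArF F) := finite_groupRing
  have hfin : Module.Finite (MonoidAlgebra ℤ G) (restrictsGraph hR) := by
    refine ⟨Submodule.fg_of_fg_map_of_fg_inf_ker r (IsNoetherian.noetherian _) ?_⟩
    rw [top_inf_eq, hex.linearMap_ker_eq, ← Module.Finite.iff_fg]
    infer_instance
  exact ⟨hfin, G0.cls_of_exact i r hi hr hex⟩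

theorem cls_restrictsGraph_eq_arTilde [Module.Finite (MonoidAlgebra ℤ G) (restrictsGraph hR)]
    [Module (MonoidAlgebra ℤ G) (InfinitePlace F →₀ ℤ)]
    (hmS : ∀ (g : G) (x : InfinitePlace F →₀ ℤ),
      (MonoidAlgebra.single g (1 : ℤ) : MonoidAlgebra ℤ G) • x =
        Finsupp.mapDomain (fun w => iso g • w) x) :
    G0.cls (MonoidAlgebra ℤ G) (restrictsGraph hR) =
      G0.cls (MonoidAlgebra ℤ G) (InfinitePlace F →₀ ℤ) +
        G0.cls (MonoidAlgebra ℤ G) (ArTilde F) := by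
  let i : (InfinitePlace F →₀ ℤ) →ₗ[MonoidAlgebra ℤ G] restrictsGraph hR :=
    AddMonoidHom.toGroupRingLinearMap
      (AddMonoidHom.mk' (fun y => ⟨(0, placesToEmb F y), ArTilde.restricts_placesToEmb y⟩)
        fun y y' => Subtype.ext (Prod.ext (add_zero (0 : ArTilde F)).symm (map_add _ y y')))
      fun g y => Subtype.ext (Prod.ext
        (smul_zero (A := ArTilde F) (MonoidAlgebra.single g (1 : ℤ) : MonoidAlgebra ℤ G)).symm
        (placesToEmb_single_smul hmS g rfl))
  let r : restrictsGraph hR →ₗ[MonoidAlgebra ℤ G] ArTilde F :=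
    (LinearMap.fst _ (ArTilde F) (EmbFun iso)).comp (restrictsGraph hR).subtype
  have hi : Function.Injective i := fun y y' h =>
    placesToEmb_injective (congrArg (fun q => q.1.2) h)
  have hr : Function.Surjective r := fun φ => by
    obtain ⟨x, hx⟩ := φ.exists_restricts
    exact ⟨⟨(φ, x), hx⟩, rfl⟩
  have hex : Function.Exact i r := fun p => by
    constructor
    · intro h
      have h0 : p.1.1 = 0 := h
      have hp : p.1.1.Restricts p.1.2 := p.2
      rw [h0] at hp
      obtain ⟨y, hy⟩ := hp.exists_placesToEmb_eq
      exact ⟨y, Subtype.ext (Prod.ext h0.symm hy)⟩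
    · rintro ⟨y, rfl⟩
      rfl
  have : Module.Finite (MonoidAlgebra ℤ G) (InfinitePlace F →₀ ℤ) := Module.Finite.of_injective i hi
  have : Module.Finite (MonoidAlgebra ℤ G) (ArTilde F) := Module.Finite.of_surjective r hr
  exact G0.cls_of_exact i r hi hr hex

end

end Equivariance

/-!
STATEMENT 11: Let F/K be a finite Galois extension of number fields with Galois group G,
let d be the degree of K over ℚ, let S∞ be the set of archimedean places of F, and let
μ_F be the group of roots of unity of F.  Then [Ãr_F] = d·[ℤ[G]] − [ℤ] holds in G₀(ℤ[G])
if and only if [Ar_F] = [ℤ[S∞]] − [ℤ] − σ[μ_F] holds in G₀(ℤ[G]).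

All ℤ[G]-module structures (via the involution g ↦ g⁻¹) and the Galois actions are
universally quantified and pinned down by pointwise characterizations; σ is
characterized by its effect on lattices (σ[M] = [Hom_ℤ(M,ℤ)]) and on finite modules
(σ[N] = −[Hom_ℤ(N,ℚ/ℤ)]).
-/
theorem stmt11
    (K F : Type) [Field K] [NumberField K] [Field F] [NumberField F] [Algebra K F]
    [IsGalois K F] (G : Type) [Group G] (iso : G ≃* (F ≃ₐ[K] F))
    -- the Galois action of G on the oriented Arakelov class group, characterized on classes
    -- of oriented Arakelov divisors (I, b) via the action on the underlying ideals and on F_ℝ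
    (ρT : G → PicTilde F → PicTilde F)
    (hρT : ∀ (g : G) (x : picDom F), ∃ y : picDom F,
      ((((((y : IdealGroup F × (FReal F)ˣ).1 : FractionalIdeal (𝓞 F)⁰ F) :
          Submodule (𝓞 F) F) : Set F)) =
        (iso g) '' (((((x : IdealGroup F × (FReal F)ˣ).1 : FractionalIdeal (𝓞 F)⁰ F) :
          Submodule (𝓞 F) F) : Set F))) ∧
      (((y : IdealGroup F × (FReal F)ˣ).2 : FReal F) =
        galFReal K (iso g) ((x : IdealGroup F × (FReal F)ˣ).2 : FReal F)) ∧
      ρT g (PicTilde.mk F x) = PicTilde.mk F y)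
    -- the ℤ[G]-module structure on the Pontryagin dual (G acting via g ↦ g⁻¹)
    [mAT : Module (MonoidAlgebra ℤ G) (ArTilde F)]
    (hmAT : ∀ (g : G) (φ : ArTilde F) (z : PicTilde F),
      ((MonoidAlgebra.single g (1 : ℤ) : MonoidAlgebra ℤ G) • φ) (Additive.ofMul z) =
        φ (Additive.ofMul (ρT g⁻¹ z)))
    -- the Galois action of G on the Arakelov class group, characterized on classes
    -- of oriented Arakelov divisors (I, b) via the action on the underlying ideals and on F_ℝ
    (ρ0 : G → PicZero F → PicZero F)
    (hρ0 : ∀ (g : G) (x : picDom F), ∃ y : picDom F,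
      ((((((y : IdealGroup F × (FReal F)ˣ).1 : FractionalIdeal (𝓞 F)⁰ F) :
          Submodule (𝓞 F) F) : Set F)) =
        (iso g) '' (((((x : IdealGroup F × (FReal F)ˣ).1 : FractionalIdeal (𝓞 F)⁰ F) :
          Submodule (𝓞 F) F) : Set F))) ∧
      (((y : IdealGroup F × (FReal F)ˣ).2 : FReal F) =
        galFReal K (iso g) ((x : IdealGroup F × (FReal F)ˣ).2 : FReal F)) ∧
      ρ0 g (PicZero.mk F x) = PicZero.mk F y)
    -- the ℤ[G]-module structure on the Pontryagin dual (G acting via g ↦ g⁻¹)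
    [mAr : Module (MonoidAlgebra ℤ G) (ArF F)]
    (hmAr : ∀ (g : G) (φ : ArF F) (z : PicZero F),
      ((MonoidAlgebra.single g (1 : ℤ) : MonoidAlgebra ℤ G) • φ) (Additive.ofMul z) =
        φ (Additive.ofMul (ρ0 g⁻¹ z)))
    -- the permutation ℤ[G]-module ℤ[S∞] on the set of archimedean places of F
    [mS : Module (MonoidAlgebra ℤ G) (NumberField.InfinitePlace F →₀ ℤ)]
    (hmS : ∀ (g : G) (x : NumberField.InfinitePlace F →₀ ℤ),
      (MonoidAlgebra.single g (1 : ℤ) : MonoidAlgebra ℤ G) • x =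
        Finsupp.mapDomain (fun w => iso g • w) x)
    -- the ℤ[G]-module μ_F of roots of unity of F
    [mMu : Module (MonoidAlgebra ℤ G) (Additive (CommGroup.torsion Fˣ))]
    (hmMu : ∀ (g : G) (u v : CommGroup.torsion Fˣ), ((v : Fˣ) : F) = iso g ((u : Fˣ) : F) →
      (MonoidAlgebra.single g (1 : ℤ) : MonoidAlgebra ℤ G) • Additive.ofMul u =
        Additive.ofMul v)
    -- the trivial ℤ[G]-module ℤ
    [mZ : Module (MonoidAlgebra ℤ G) ℤ]
    (hmZ : ∀ (g : G) (n : ℤ),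
      (MonoidAlgebra.single g (1 : ℤ) : MonoidAlgebra ℤ G) • n = n)
    -- σ : the duality endomorphism of G₀(ℤ[G]) induced by M ↦ Hom_ℤ(M,ℤ) on lattices
    -- (with G acting via the involution g ↦ g⁻¹); on a finite module N it satisfies
    -- σ[N] = −[Hom_ℤ(N, ℚ/ℤ)]
    (σ : G0 (MonoidAlgebra ℤ G) →+ G0 (MonoidAlgebra ℤ G))
    (hσlat : ∀ (M : Type) [AddCommGroup M] [Module (MonoidAlgebra ℤ G) M]
        [Module.Finite (MonoidAlgebra ℤ G) M] [Module.Projective ℤ M]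
        [Module (MonoidAlgebra ℤ G) (M →ₗ[ℤ] ℤ)],
      (∀ (g : G) (φ : M →ₗ[ℤ] ℤ) (x : M),
        ((MonoidAlgebra.single g (1 : ℤ) : MonoidAlgebra ℤ G) • φ) x =
          φ ((MonoidAlgebra.single g⁻¹ (1 : ℤ) : MonoidAlgebra ℤ G) • x)) →
      σ (G0.cls (MonoidAlgebra ℤ G) M) = G0.cls (MonoidAlgebra ℤ G) (M →ₗ[ℤ] ℤ))
    (hσtor : ∀ (N : Type) [AddCommGroup N] [Module (MonoidAlgebra ℤ G) N]
        [Module (MonoidAlgebra ℤ G) (N →ₗ[ℤ] QmodZ)], Finite N →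
      (∀ (g : G) (φ : N →ₗ[ℤ] QmodZ) (x : N),
        ((MonoidAlgebra.single g (1 : ℤ) : MonoidAlgebra ℤ G) • φ) x =
          φ ((MonoidAlgebra.single g⁻¹ (1 : ℤ) : MonoidAlgebra ℤ G) • x)) →
      σ (G0.cls (MonoidAlgebra ℤ G) N) = - G0.cls (MonoidAlgebra ℤ G) (N →ₗ[ℤ] QmodZ))
 :
    (G0.cls (MonoidAlgebra ℤ G) (ArTilde F) =
      (Module.finrank ℚ K) • G0.cls (MonoidAlgebra ℤ G) (MonoidAlgebra ℤ G) -
        G0.cls (MonoidAlgebra ℤ G) ℤ) ↔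
    (G0.cls (MonoidAlgebra ℤ G) (ArF F) =
      G0.cls (MonoidAlgebra ℤ G) (NumberField.InfinitePlace F →₀ ℤ) -
        G0.cls (MonoidAlgebra ℤ G) ℤ -
        σ (G0.cls (MonoidAlgebra ℤ G) (Additive (CommGroup.torsion Fˣ)))) := by
  have : Finite G := Finite.of_equiv _ iso.symm.toEquiv
  let M := Additive (CommGroup.torsion Fˣ)
  letI : Module (MonoidAlgebra ℤ G) (M →ₗ[ℤ] QmodZ) := groupRingModule (dualRep M)
  have hdual : ∀ (g : G) (φ : M →ₗ[ℤ] QmodZ) (x : M),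
      ((MonoidAlgebra.single g (1 : ℤ) : MonoidAlgebra ℤ G) • φ) x =
        φ ((MonoidAlgebra.single g⁻¹ (1 : ℤ) : MonoidAlgebra ℤ G) • x) := fun g φ x => by
    rw [groupRingModule_single_smul]
    rfl
  have hσ := hσtor M (inferInstanceAs (Finite (CommGroup.torsion Fˣ))) hdual
  have hemb := cls_embFun_eq_torsionTrivial_add hmMu hdual
  rw [cls_embFun] at hemb
  have hR := fun (g : G) (φ : ArTilde F) (x : EmbFun iso) =>
    ArTilde.Restricts.single_smul hρT hmAT g (φ := φ) (x := x)
  obtain ⟨hfin, hAr⟩ := finite_and_cls_restrictsGraph hR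
    (ArF.inflate_single_smul hρT hmAT hρ0 hmAr)
  have hAT := cls_restrictsGraph_eq_arTilde hR hmS
  rw [hAr] at hAT
  rw [hσ, hemb]
  constructor
  · intro h
    rw [h] at hAT
    rw [← sub_eq_zero] at hAT ⊢
    rw [← hAT]
    abel
  · intro h
    rw [h] at hAT
    rw [← sub_eq_zero] at hAT ⊢
    rw [← neg_eq_zero, ← hAT]
    abel
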